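/- arXiv:1302.3081 — 5 statements merged into one kernel-verified Lean document; each statement's English description precedes it below -/
import Mathlib

section
/- Let P₁ and P₂ be finite sets of points in ℝ², with |P₁| = n and |P₂| = m, such that all points of P₁ lie on a line ℓ₁, all points of P₂ lie on a line ℓ₂, and ℓ₁ and ℓ₂ are neither parallel nor orthogonal. Then the number of distinct distances D(P₁,P₂) = |{dist(p,q) : p ∈ P₁, q ∈ P₂}| satisfies D(P₁,P₂) = Ω(min{n^{2/3} m^{2/3}, n², m²}); that is, there exists an absolute constant c > 0 (independent of P₁, P₂, ℓ₁, ℓ₂, n, m) such that D(P₁,P₂) ≥ c · min{n^{2/3} m^{2/3}, n², m²}. -/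
open scoped Classical RealInnerProductSpace

section Counting

variable {α β γ κ : Type*}

/-- Cauchy–Schwarz: the square of the size of a set is at most the number of values of a function
on it times the number of pairs on which the function agrees. -/
lemma card_sq_le_card_image_mul_card_pairs (Z : Finset α) (g : α → β) :
    Z.card ^ 2 ≤ (Z.image g).card * ((Z ×ˢ Z).filter (fun w => g w.1 = g w.2)).card := by
  have h1 : Z.card = ∑ d ∈ Z.image g, (Z.filter (fun z => g z = d)).card :=
    Finset.card_eq_sum_card_image g Z
  have h2 : ((Z ×ˢ Z).filter (fun w => g w.1 = g w.2)).card
      = ∑ d ∈ Z.image g, (Z.filter (fun z => g z = d)).card ^ 2 := by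
    rw [Finset.card_eq_sum_card_fiberwise (f := fun w : α × α => g w.1) (t := Z.image g)]
    · refine Finset.sum_congr rfl fun d _ => ?_
      rw [sq, ← Finset.card_product]
      congr 1
      ext ⟨x, y⟩
      simp only [Finset.mem_filter, Finset.mem_product]
      constructor
      · rintro ⟨⟨⟨hx, hy⟩, hxy⟩, hd⟩
        exact ⟨⟨hx, hd⟩, hy, hxy ▸ hd⟩
      · rintro ⟨⟨hx, hd⟩, hy, hd'⟩
        exact ⟨⟨⟨hx, hy⟩, hd.trans hd'.symm⟩, hd⟩
    · intro w hw
      simp only [Finset.coe_filter, Finset.mem_product, Set.mem_ofPred_eq] at hw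
      exact Finset.mem_coe.2 (Finset.mem_image_of_mem g hw.1.1)
  rw [h2]
  nth_rewrite 1 [h1]
  exact sq_sum_le_card_mul_sum_sq

/-- A set coloured by `K` has at most `#K` elements plus the number of ordered pairs of distinct
elements having the same colour. -/
lemma card_le_card_add_card_offDiag (S : Finset α) (K : Finset κ) (f : α → κ)
    (hf : ∀ p ∈ S, f p ∈ K) :
    S.card ≤ K.card + ((S ×ˢ S).filter (fun w => w.1 ≠ w.2 ∧ f w.1 = f w.2)).card := by
  have h2 : ((S ×ˢ S).filter (fun w => w.1 ≠ w.2 ∧ f w.1 = f w.2)).card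
      = ∑ d ∈ K, (S.filter (fun z => f z = d)).offDiag.card := by
    rw [Finset.card_eq_sum_card_fiberwise (f := fun w : α × α => f w.1) (t := K)]
    · refine Finset.sum_congr rfl fun d _ => ?_
      congr 1
      ext ⟨x, y⟩
      simp only [Finset.mem_filter, Finset.mem_product, Finset.mem_offDiag]
      constructor
      · rintro ⟨⟨⟨hx, hy⟩, hne, hxy⟩, hd⟩
        exact ⟨⟨hx, hd⟩, ⟨hy, hxy ▸ hd⟩, hne⟩
      · rintro ⟨⟨hx, hd⟩, ⟨hy, hd'⟩, hne⟩
        exact ⟨⟨⟨hx, hy⟩, hne, hd.trans hd'.symm⟩, hd⟩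
    · intro w hw
      simp only [Finset.coe_filter, Finset.mem_product, Set.mem_ofPred_eq] at hw
      exact Finset.mem_coe.2 (hf _ hw.1.1)
  rw [h2, Finset.card_eq_sum_card_fiberwise (f := f) (t := K) hf, Finset.card_eq_sum_ones K,
    ← Finset.sum_add_distrib]
  refine Finset.sum_le_sum fun d _ => ?_
  rw [Finset.offDiag_card]
  generalize (S.filter (fun z => f z = d)).card = k
  rcases Nat.lt_or_ge k 2 with h | h
  · omega
  · have : 2 * k ≤ k * k := Nat.mul_le_mul_right k h
    omega

/-- An incidence bound by cell decomposition: if the points of each curve are coloured by `K` so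
that points of the same colour lie in the same cell, any two distinct points lie on at most two
common curves, and every cell has at most `N` points, then there are at most
`#X * #K + 2 * #Y * N` incidences. -/
lemma card_incidences_le (X : Finset α) (Y : Finset β) (K : Finset κ) (R : α → β → Prop)
    (key : α → β → κ) (cell : β → γ) (N : ℕ)
    (hkey : ∀ x ∈ X, ∀ p ∈ Y, key x p ∈ K)
    (hcell : ∀ x ∈ X, ∀ p ∈ Y, ∀ q ∈ Y, R x p → R x q → key x p = key x q → cell p = cell q)
    (htwo : ∀ p ∈ Y, ∀ q ∈ Y, p ≠ q → (X.filter (fun x => R x p ∧ R x q)).card ≤ 2)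
    (hN : ∀ p ∈ Y, (Y.filter (fun q => cell q = cell p)).card ≤ N) :
    ((X ×ˢ Y).filter (fun w => R w.1 w.2)).card ≤ X.card * K.card + 2 * Y.card * N := by
  have h1 : ((X ×ˢ Y).filter (fun w => R w.1 w.2)).card
      = ∑ x ∈ X, (Y.filter (fun p => R x p)).card := by
    simp only [Finset.card_filter, Finset.sum_product]
  set W := (Y ×ˢ Y).filter (fun w => w.1 ≠ w.2 ∧ cell w.2 = cell w.1) with hW
  have hWcard : W.card ≤ Y.card * N := by
    calc W.card ≤ ((Y ×ˢ Y).filter (fun w => cell w.2 = cell w.1)).card := by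
          refine Finset.card_le_card fun w hw => ?_
          simp only [hW, Finset.mem_filter] at hw ⊢
          exact ⟨hw.1, hw.2.2⟩
      _ = ∑ p ∈ Y, (Y.filter (fun q => cell q = cell p)).card := by
          simp only [Finset.card_filter, Finset.sum_product]
      _ ≤ ∑ p ∈ Y, N := Finset.sum_le_sum hN
      _ = Y.card * N := by simp
  have h2 : ∀ x ∈ X, (Y.filter (fun p => R x p)).card
      ≤ K.card + (W.filter (fun w => R x w.1 ∧ R x w.2)).card := by
    intro x hx
    refine (card_le_card_add_card_offDiag _ K (key x) ?_).trans ?_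
    · intro p hp
      exact hkey x hx p (Finset.mem_filter.1 hp).1
    · refine Nat.add_le_add_left (Finset.card_le_card fun w hw => ?_) _
      simp only [hW, Finset.mem_filter, Finset.mem_product] at hw ⊢
      obtain ⟨⟨⟨hp, hRp⟩, hq, hRq⟩, hne, hk⟩ := hw
      exact ⟨⟨⟨hp, hq⟩, hne, (hcell x hx _ hp _ hq hRp hRq hk).symm⟩, hRp, hRq⟩
  calc ((X ×ˢ Y).filter (fun w => R w.1 w.2)).card
      ≤ ∑ x ∈ X, (K.card + (W.filter (fun w => R x w.1 ∧ R x w.2)).card) := by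
        rw [h1]; exact Finset.sum_le_sum h2
    _ = X.card * K.card + ∑ w ∈ W, (X.filter (fun x => R x w.1 ∧ R x w.2)).card := by
        rw [Finset.sum_add_distrib, Finset.sum_const, smul_eq_mul]
        congr 1
        simp only [Finset.card_filter]
        exact Finset.sum_comm
    _ ≤ X.card * K.card + ∑ w ∈ W, 2 := by
        refine Nat.add_le_add_left (Finset.sum_le_sum fun w hw => ?_) _
        simp only [hW, Finset.mem_filter, Finset.mem_product] at hw
        exact htwo _ hw.1.1 _ hw.1.2 hw.2.1
    _ ≤ X.card * K.card + 2 * Y.card * N := by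
        rw [Finset.sum_const, smul_eq_mul]
        nlinarith

end Counting

section Blocks

/-- The index of the block containing `x` when `B` is cut into consecutive blocks of `s` points. -/
noncomputable def blockIndex (B : Finset ℝ) (s : ℕ) (x : ℝ) : ℕ :=
  (B.filter (fun y => y < x)).card / s

lemma blockIndex_mono (B : Finset ℝ) (s : ℕ) : Monotone (blockIndex B s) := by
  intro x y hxy
  refine Nat.div_le_div_right (Finset.card_le_card fun z hz => ?_)
  simp only [Finset.mem_filter] at hz ⊢
  exact ⟨hz.1, hz.2.trans_le hxy⟩

lemma blockIndex_le (B : Finset ℝ) (s : ℕ) (x : ℝ) : blockIndex B s x ≤ B.card / s :=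
  Nat.div_le_div_right (Finset.card_filter_le _ _)

lemma card_block_le (B : Finset ℝ) {s : ℕ} (hs : 0 < s) (i : ℕ) :
    (B.filter (fun x => blockIndex B s x = i)).card ≤ s := by
  have hinj : Set.InjOn (fun x : ℝ => (B.filter (fun y => y < x)).card)
      (B.filter (fun x => blockIndex B s x = i) : Finset ℝ) := by
    have key : ∀ x ∈ B, ∀ y, x < y →
        (B.filter (fun z => z < x)).card < (B.filter (fun z => z < y)).card := by
      intro x hx y hxy
      refine Finset.card_lt_card ⟨fun z hz => ?_, fun h => ?_⟩
      · simp only [Finset.mem_filter] at hz ⊢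
        exact ⟨hz.1, hz.2.trans hxy⟩
      · have := h (Finset.mem_filter.2 ⟨hx, hxy⟩)
        simp at this
    intro x hx y hy hxy
    simp only [Finset.coe_filter, Set.mem_ofPred_eq] at hx hy
    rcases lt_trichotomy x y with h | h | h
    · exact absurd hxy (key x hx.1 y h).ne
    · exact h
    · exact absurd hxy (key y hy.1 x h).ne'
  rw [← Finset.card_image_of_injOn hinj]
  calc _ ≤ (Finset.Ico (i * s) (i * s + s)).card := by
        refine Finset.card_le_card fun k hk => ?_
        simp only [Finset.mem_image, Finset.mem_filter] at hk
        obtain ⟨x, ⟨_, hx⟩, rfl⟩ := hk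
        rw [blockIndex, Nat.div_eq_iff hs] at hx
        rw [Finset.mem_Ico]
        omega
    _ = s := by simp

end Blocks

section Conics

/-- A line meets a nondegenerate conic `x² - y² = k` in at most two points. -/
lemma line_inter_hyperbola {a b c k x₁ y₁ x₂ y₂ x₃ y₃ : ℝ} (hk : k ≠ 0) (hb : b ≠ 0)
    (l₁ : a * x₁ + b * y₁ = c) (l₂ : a * x₂ + b * y₂ = c) (l₃ : a * x₃ + b * y₃ = c)
    (c₁ : x₁ ^ 2 - y₁ ^ 2 = k) (c₂ : x₂ ^ 2 - y₂ ^ 2 = k) (c₃ : x₃ ^ 2 - y₃ ^ 2 = k)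
    (h₁₂ : (x₁, y₁) ≠ (x₂, y₂)) (h₁₃ : (x₁, y₁) ≠ (x₃, y₃)) (h₂₃ : (x₂, y₂) ≠ (x₃, y₃)) :
    False := by
  have sol : ∀ x y, a * x + b * y = c → y = c / b + (-a / b) * x := by
    intro x y h
    field_simp
    linarith
  obtain rfl := sol _ _ l₁
  obtain rfl := sol _ _ l₂
  obtain rfl := sol _ _ l₃
  generalize c / b = d at *
  generalize -a / b = μ at *
  have n₁₂ : x₁ - x₂ ≠ 0 := fun h => h₁₂ (by rw [sub_eq_zero.1 h])
  have n₁₃ : x₁ - x₃ ≠ 0 := fun h => h₁₃ (by rw [sub_eq_zero.1 h])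
  have n₂₃ : x₂ - x₃ ≠ 0 := fun h => h₂₃ (by rw [sub_eq_zero.1 h])
  have e₁₂ : (1 - μ ^ 2) * (x₁ + x₂) - 2 * d * μ = 0 := by
    refine (mul_eq_zero.1 (?_ : (x₁ - x₂) * _ = 0)).resolve_left n₁₂
    linear_combination c₁ - c₂
  have e₁₃ : (1 - μ ^ 2) * (x₁ + x₃) - 2 * d * μ = 0 := by
    refine (mul_eq_zero.1 (?_ : (x₁ - x₃) * _ = 0)).resolve_left n₁₃
    linear_combination c₁ - c₃
  have hμ : 1 - μ ^ 2 = 0 := by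
    refine (mul_eq_zero.1 (?_ : (x₂ - x₃) * _ = 0)).resolve_left n₂₃
    linear_combination e₁₂ - e₁₃
  have hdμ : d * μ = 0 := by linear_combination (x₁ + x₂) / 2 * hμ - e₁₂ / 2
  have hd : d = 0 := by linear_combination d * hμ + μ * hdμ
  subst hd
  exact hk (by linear_combination x₁ ^ 2 * hμ - c₁)

/-- The squared distance between the points at signed distances `a` and `b` from the intersection
point of two lines which meet at an angle of cosine `l`. -/
def sqDistForm (l a b : ℝ) : ℝ := a ^ 2 + b ^ 2 - 2 * l * a * b

variable {l : ℝ}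

lemma card_common_le_two (hl : l ≠ 0) (hl1 : l ^ 2 ≠ 1) (X : Finset (ℝ × ℝ)) {p q : ℝ × ℝ}
    (hp : p.1 ^ 2 ≠ p.2 ^ 2) (hpq : p ≠ q) :
    (X.filter (fun x => sqDistForm l x.1 p.1 = sqDistForm l x.2 p.2 ∧
      sqDistForm l x.1 q.1 = sqDistForm l x.2 q.2)).card ≤ 2 := by
  by_contra! hcard
  obtain ⟨⟨x₁, y₁⟩, ⟨x₂, y₂⟩, ⟨x₃, y₃⟩, h₁, h₂, h₃, h₁₂, h₁₃, h₂₃⟩ :=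
    Finset.two_lt_card_iff.1 hcard
  obtain ⟨b, b'⟩ := p
  obtain ⟨c, c'⟩ := q
  simp only [Finset.mem_filter] at h₁ h₂ h₃
  simp only [sqDistForm] at h₁ h₂ h₃ hp
  obtain ⟨-, e₁, f₁⟩ := h₁
  obtain ⟨-, e₂, f₂⟩ := h₂
  obtain ⟨-, e₃, f₃⟩ := h₃
  set k : ℝ := (1 - l ^ 2) * (b' ^ 2 - b ^ 2) with hkdef
  have hk : k ≠ 0 := mul_ne_zero (sub_ne_zero.2 hl1.symm) (sub_ne_zero.2 hp.symm)
  have shift : ∀ {x y z w : ℝ}, (x, y) ≠ (z, w) →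
      (x - l * b, y - l * b') ≠ (z - l * b, w - l * b') := by
    intro x y z w h h'
    simp only [Prod.mk.injEq, sub_left_inj] at h'
    exact h (by rw [h'.1, h'.2])
  have shift' : ∀ {x y z w : ℝ}, (x, y) ≠ (z, w) →
      (y - l * b', x - l * b) ≠ (w - l * b', z - l * b) := by
    intro x y z w h h'
    simp only [Prod.mk.injEq, sub_left_inj] at h'
    exact h (by rw [h'.1, h'.2])
  set d : ℝ := (b ^ 2 - b' ^ 2 - c ^ 2 + c' ^ 2)
    - 2 * l * (b - c) * (l * b) + 2 * l * (b' - c') * (l * b') with hd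
  by_cases hb : b' = c'
  · have hb' : b ≠ c := fun h => hpq (by rw [h, hb])
    refine line_inter_hyperbola (a := -(2 * l * (b' - c'))) (b := 2 * l * (b - c)) (c := d)
      (k := -k) (neg_ne_zero.2 hk) (mul_ne_zero (mul_ne_zero two_ne_zero hl) (sub_ne_zero.2 hb'))
      ?_ ?_ ?_ ?_ ?_ ?_ (shift' h₁₂) (shift' h₁₃) (shift' h₂₃)
    · linear_combination f₁ - e₁
    · linear_combination f₂ - e₂
    · linear_combination f₃ - e₃
    · linear_combination -e₁
    · linear_combination -e₂
    · linear_combination -e₃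
  · refine line_inter_hyperbola (a := 2 * l * (b - c)) (b := -(2 * l * (b' - c'))) (c := d)
      hk (neg_ne_zero.2 (mul_ne_zero (mul_ne_zero two_ne_zero hl) (sub_ne_zero.2 hb)))
      ?_ ?_ ?_ ?_ ?_ ?_ (shift h₁₂) (shift h₁₃) (shift h₂₃)
    · linear_combination f₁ - e₁
    · linear_combination f₂ - e₂
    · linear_combination f₃ - e₃
    · linear_combination e₁
    · linear_combination e₂
    · linear_combination e₃

/-- The colour of the point `p` on the hyperbola with centre `z`: its quadrant, and the index of
the (anti)diagonal of the `t × t` grid of blocks containing it. -/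
noncomputable def hyperbolaKey (f : ℝ → ℕ) (t : ℕ) (z p : ℝ × ℝ) : Prop × Prop × ℕ :=
  (z.1 ≤ p.1, z.2 ≤ p.2,
    if (z.1 ≤ p.1 ↔ z.2 ≤ p.2) then f p.1 + f p.2 else f p.1 + (t - f p.2))

lemma block_eq_of_hyperbolaKey_eq {f : ℝ → ℕ} (hf : Monotone f) {t : ℕ} (hft : ∀ x, f x ≤ t)
    {z p q : ℝ × ℝ} {k : ℝ}
    (hp : (p.1 - z.1) ^ 2 - (p.2 - z.2) ^ 2 = k) (hq : (q.1 - z.1) ^ 2 - (q.2 - z.2) ^ 2 = k)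
    (h : hyperbolaKey f t z p = hyperbolaKey f t z q) : f p.1 = f q.1 ∧ f p.2 = f q.2 := by
  wlog hc : |p.1 - z.1| ≤ |q.1 - z.1| generalizing p q
  · have := this hq hp h.symm (not_le.1 hc).le
    exact ⟨this.1.symm, this.2.symm⟩
  have hc' : |p.2 - z.2| ≤ |q.2 - z.2| := by
    rw [← sq_le_sq] at hc ⊢
    linarith
  simp only [hyperbolaKey, Prod.mk.injEq, eq_iff_iff] at h
  obtain ⟨h1, h2, h3⟩ := h
  have t1 := hft p.2
  have t2 := hft q.2
  by_cases s1 : z.1 ≤ p.1 <;> by_cases s2 : z.2 ≤ p.2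
  · have s1' := h1.1 s1
    have s2' := h2.1 s2
    simp only [s1, s2, s1', s2', if_true] at h3
    rw [abs_of_nonneg (by linarith), abs_of_nonneg (by linarith)] at hc hc'
    have := hf (show p.1 ≤ q.1 by linarith)
    have := hf (show p.2 ≤ q.2 by linarith)
    omega
  · have s1' := h1.1 s1
    have s2' := mt h2.2 s2
    simp only [s1, s2, s1', s2', iff_false, not_true_eq_false, if_false] at h3
    rw [abs_of_nonneg (by linarith), abs_of_nonneg (by linarith)] at hc
    rw [abs_of_neg (by linarith), abs_of_neg (by linarith)] at hc'
    have := hf (show p.1 ≤ q.1 by linarith)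
    have := hf (show q.2 ≤ p.2 by linarith)
    omega
  · have s1' := mt h1.2 s1
    have s2' := h2.1 s2
    simp only [s1, s2, s1', s2', iff_true, if_false] at h3
    rw [abs_of_neg (by linarith), abs_of_neg (by linarith)] at hc
    rw [abs_of_nonneg (by linarith), abs_of_nonneg (by linarith)] at hc'
    have := hf (show q.1 ≤ p.1 by linarith)
    have := hf (show p.2 ≤ q.2 by linarith)
    omega
  · have s1' := mt h1.2 s1
    have s2' := mt h2.2 s2
    simp only [s1, s2, s1', s2', if_true] at h3
    rw [abs_of_neg (by linarith), abs_of_neg (by linarith)] at hc hc'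
    have := hf (show q.1 ≤ p.1 by linarith)
    have := hf (show q.2 ≤ p.2 by linarith)
    omega

/-- The number of quadruples `(a, a', b, b')` with `b² ≠ b'²` such that `(a, b)` and `(a', b')`
span the same distance. -/
lemma card_nondegenerate_le (hl : l ≠ 0) (hl1 : l ^ 2 ≠ 1) (A B : Finset ℝ) {s : ℕ}
    (hs : 0 < s) :
    (((A ×ˢ A) ×ˢ ((B ×ˢ B).filter (fun p => p.1 ^ 2 ≠ p.2 ^ 2))).filter
      (fun w => sqDistForm l w.1.1 w.2.1 = sqDistForm l w.1.2 w.2.2)).card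
      ≤ A.card ^ 2 * (4 * (2 * (B.card / s) + 1)) + 2 * B.card ^ 2 * s ^ 2 := by
  set Y := (B ×ˢ B).filter (fun p : ℝ × ℝ => p.1 ^ 2 ≠ p.2 ^ 2) with hY
  set t := B.card / s with ht
  set f := blockIndex B s with hf
  set K : Finset (Prop × Prop × ℕ) :=
    Finset.univ ×ˢ Finset.univ ×ˢ Finset.range (2 * t + 1) with hK
  have hft : ∀ x, f x ≤ t := blockIndex_le B s
  have main := card_incidences_le (A ×ˢ A) Y K
    (fun x p => sqDistForm l x.1 p.1 = sqDistForm l x.2 p.2)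
    (fun x p => hyperbolaKey f t (l * x.1, l * x.2) p) (fun p => (f p.1, f p.2)) (s ^ 2)
    ?_ ?_ ?_ ?_
  · refine main.trans ?_
    have hKc : K.card = 4 * (2 * t + 1) := by
      simp only [hK, Finset.card_product, Finset.card_univ, Fintype.card_prop, Finset.card_range]
      ring
    have hYc : Y.card ≤ B.card ^ 2 := by
      refine (Finset.card_filter_le _ _).trans ?_
      rw [Finset.card_product, sq]
    rw [Finset.card_product, hKc, ← sq]
    gcongr
  · intro x _ p _
    have h1 := hft p.1
    have h2 := hft p.2
    simp only [hK, hyperbolaKey, Finset.mem_product, Finset.mem_univ, true_and, Finset.mem_range]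
    split_ifs <;> omega
  · intro x _ p _ q _ hp hq h
    simp only [sqDistForm] at hp hq
    have := block_eq_of_hyperbolaKey_eq (blockIndex_mono B s) hft
      (k := (1 - l ^ 2) * (x.2 ^ 2 - x.1 ^ 2))
      (by linear_combination hp) (by linear_combination hq) h
    exact Prod.ext this.1 this.2
  · intro p hp q _ hpq
    exact card_common_le_two hl hl1 _ (Finset.mem_filter.1 hp).2 hpq
  · intro p _
    calc _ ≤ ((B.filter (fun x => f x = f p.1)) ×ˢ (B.filter (fun x => f x = f p.2))).card := by
          refine Finset.card_le_card fun q hq => ?_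
          simp only [hY, Finset.mem_filter, Finset.mem_product, Prod.mk.injEq] at hq ⊢
          exact ⟨⟨hq.1.1.1, hq.2.1⟩, hq.1.1.2, hq.2.2⟩
      _ ≤ s ^ 2 := by
          rw [Finset.card_product, sq]
          exact Nat.mul_le_mul (card_block_le B hs _) (card_block_le B hs _)

/-- The number of quadruples `(a, b, a', b')` with `b² = b'²` such that `(a, b)` and `(a', b')`
span the same distance. -/
lemma card_degenerate_le (Z : Finset (ℝ × ℝ)) :
    ((Z ×ˢ Z).filter (fun w => sqDistForm l w.1.1 w.1.2 = sqDistForm l w.2.1 w.2.2 ∧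
      w.1.2 ^ 2 = w.2.2 ^ 2)).card ≤ 4 * Z.card := by
  have h : ((Z ×ˢ Z).filter (fun w => sqDistForm l w.1.1 w.1.2 = sqDistForm l w.2.1 w.2.2 ∧
      w.1.2 ^ 2 = w.2.2 ^ 2)).card = ∑ z ∈ Z, (Z.filter (fun w =>
        sqDistForm l z.1 z.2 = sqDistForm l w.1 w.2 ∧ z.2 ^ 2 = w.2 ^ 2)).card := by
    simp only [Finset.card_filter, Finset.sum_product]
  rw [h, mul_comm, ← smul_eq_mul]
  refine Finset.sum_le_card_nsmul _ _ _ fun z _ => ?_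
  refine (Finset.card_le_card (t := {(z.1, z.2), (2 * l * z.2 - z.1, z.2), (-z.1, -z.2),
    (z.1 - 2 * l * z.2, -z.2)}) fun w hw => ?_).trans Finset.card_le_four
  obtain ⟨a, b⟩ := z
  obtain ⟨a', b'⟩ := w
  rw [Finset.mem_filter] at hw
  simp only [sqDistForm] at hw
  obtain ⟨-, e, h2⟩ := hw
  simp only [Finset.mem_insert, Finset.mem_singleton, Prod.mk.injEq]
  rcases sq_eq_sq_iff_eq_or_eq_neg.1 h2 with rfl | rfl
  · have : (a' - a) * (a' - (2 * l * b - a)) = 0 := by linear_combination -e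
    rcases mul_eq_zero.1 this with h | h
    · exact Or.inl ⟨by linarith, rfl⟩
    · exact Or.inr (Or.inl ⟨by linarith, rfl⟩)
  · have : (a' + a) * (a' - (a + 2 * l * b')) = 0 := by linear_combination -e
    rcases mul_eq_zero.1 this with h | h
    · exact Or.inr (Or.inr (Or.inl ⟨by linarith, by ring⟩))
    · exact Or.inr (Or.inr (Or.inr ⟨by linarith, by ring⟩))

lemma card_mul_sq_le (hl : l ≠ 0) (hl1 : l ^ 2 ≠ 1) (A B : Finset ℝ) {s : ℕ} (hs : 0 < s) :
    (A.card * B.card) ^ 2 ≤ ((A ×ˢ B).image (fun z => sqDistForm l z.1 z.2)).card *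
      (A.card ^ 2 * (4 * (2 * (B.card / s) + 1)) + 2 * B.card ^ 2 * s ^ 2
        + 4 * (A.card * B.card)) := by
  rw [← Finset.card_product]
  refine (card_sq_le_card_image_mul_card_pairs (A ×ˢ B) fun z => sqDistForm l z.1 z.2).trans ?_
  refine Nat.mul_le_mul_left _ ?_
  refine le_trans ?_
    (Nat.add_le_add (card_nondegenerate_le hl hl1 A B hs) (card_degenerate_le (l := l) (A ×ˢ B)))
  rw [← Finset.card_filter_add_card_filter_not
    (s := ((A ×ˢ B) ×ˢ (A ×ˢ B)).filter _) (fun w => w.1.2 ^ 2 ≠ w.2.2 ^ 2)]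
  refine Nat.add_le_add ?_ (Finset.card_le_card fun w hw => ?_)
  · refine Finset.card_le_card_of_injOn (fun w => ((w.1.1, w.2.1), (w.1.2, w.2.2))) ?_ ?_
    · intro w hw
      simp only [Finset.coe_filter, Finset.mem_filter, Finset.mem_product, Set.mem_ofPred_eq] at hw ⊢
      tauto
    · rintro ⟨⟨a, b⟩, c, d⟩ _ ⟨⟨a', b'⟩, c', d'⟩ _ h
      simp only [Prod.mk.injEq] at h ⊢
      tauto
  · simp only [Finset.mem_filter, not_not] at hw ⊢
    tauto

end Conics

lemma min_le_of_forall_card_bound {n m D : ℕ}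
    (h : ∀ s : ℕ, 0 < s → (n * m) ^ 2 ≤
      D * (n ^ 2 * (4 * (2 * (m / s) + 1)) + 2 * m ^ 2 * s ^ 2 + 4 * (n * m))) :
    1 / 24 * min ((n : ℝ) ^ (2/3 : ℝ) * (m : ℝ) ^ (2/3 : ℝ)) (min ((n : ℝ) ^ 2) ((m : ℝ) ^ 2))
      ≤ D := by
  rcases Nat.eq_zero_or_pos n with rfl | hn
  · refine le_trans (mul_nonpos_of_nonneg_of_nonpos (by norm_num)
      ((min_le_right _ _).trans ((min_le_left _ _).trans (by simp)))) (Nat.cast_nonneg D)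
  rcases Nat.eq_zero_or_pos m with rfl | hm
  · refine le_trans (mul_nonpos_of_nonneg_of_nonpos (by norm_num)
      ((min_le_right _ _).trans ((min_le_right _ _).trans (by simp)))) (Nat.cast_nonneg D)
  have cube : ∀ k : ℕ, 0 < k →
      ∃ u : ℝ, 1 ≤ u ∧ (k : ℝ) = u ^ 3 ∧ (k : ℝ) ^ (2/3 : ℝ) = u ^ 2 := by
    intro k hk
    refine ⟨(k : ℝ) ^ (1/3 : ℝ), Real.one_le_rpow (by exact_mod_cast hk) (by norm_num), ?_, ?_⟩
    · rw [← Real.rpow_natCast, ← Real.rpow_mul (Nat.cast_nonneg k)]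
      norm_num
    · rw [← Real.rpow_natCast, ← Real.rpow_mul (Nat.cast_nonneg k)]
      norm_num
  obtain ⟨u, hu, hnu, hnu'⟩ := cube n hn
  obtain ⟨v, hv, hmv, hmv'⟩ := cube m hm
  have hu0 : 0 < u := by linarith
  have hv0 : 0 < v := by linarith
  have hD : (0 : ℝ) ≤ D := Nat.cast_nonneg D
  have hR : ∀ s : ℕ, 0 < s → u ^ 6 * v ^ 6 ≤
      D * (u ^ 6 * (4 * (2 * (v ^ 3 / s) + 1)) + 2 * v ^ 6 * s ^ 2 + 4 * (u ^ 3 * v ^ 3)) := by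
    intro s hs
    have h1 : ((m / s : ℕ) : ℝ) ≤ v ^ 3 / s := hmv ▸ Nat.cast_div_le
    have h2 : ((n * m : ℝ)) ^ 2 ≤ D * ((n : ℝ) ^ 2 * (4 * (2 * ((m / s : ℕ) : ℝ) + 1))
        + 2 * (m : ℝ) ^ 2 * (s : ℝ) ^ 2 + 4 * (n * m)) := by exact_mod_cast h s hs
    rw [hnu, hmv] at h2
    calc u ^ 6 * v ^ 6 = (u ^ 3 * v ^ 3) ^ 2 := by ring
      _ ≤ _ := h2
      _ = D * (u ^ 6 * (4 * (2 * ((m / s : ℕ) : ℝ) + 1)) + 2 * v ^ 6 * s ^ 2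
          + 4 * (u ^ 3 * v ^ 3)) := by ring
      _ ≤ _ := by gcongr
  rw [hnu', hmv', hnu, hmv]
  rcases le_total (u ^ 2) v with huv | huv
  · have h1 := hR 1 one_pos
    have e1 : u ^ 6 ≤ v ^ 3 := by
      calc u ^ 6 = (u ^ 2) ^ 3 := by ring
        _ ≤ v ^ 3 := by gcongr
    have e2 : u ^ 3 ≤ v ^ 3 := (pow_le_pow_right₀ hu (by norm_num : 3 ≤ 6)).trans e1
    have hone : 1 ≤ v ^ 3 := one_le_pow₀ hv
    have h3 : v ^ 6 * u ^ 6 ≤ v ^ 6 * (D * 24) := by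
      calc v ^ 6 * u ^ 6 = u ^ 6 * v ^ 6 := by ring
        _ ≤ _ := h1
        _ ≤ D * (v ^ 3 * (4 * (2 * v ^ 3 + v ^ 3)) + 2 * v ^ 6 * 1 + 4 * (v ^ 3 * v ^ 3)) := by
            rw [Nat.cast_one, div_one, one_pow]
            gcongr
        _ ≤ v ^ 6 * (D * 24) := by
            have : 0 ≤ D * v ^ 6 := by positivity
            nlinarith
    have h4 := le_of_mul_le_mul_left h3 (by positivity)
    have h5 : min (u ^ 2 * v ^ 2) (min ((u ^ 3) ^ 2) ((v ^ 3) ^ 2)) ≤ u ^ 6 :=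
      (min_le_right _ _).trans ((min_le_left _ _).trans (by rw [← pow_mul]))
    linarith
  · set s := ⌈u ^ 2 / v⌉₊ with hs
    have hx : 1 ≤ u ^ 2 / v := (one_le_div hv0).2 huv
    have hs0 : 0 < s := Nat.ceil_pos.2 (by linarith)
    have hs1 : u ^ 2 / v ≤ s := Nat.le_ceil _
    have hs2 : (s : ℝ) ≤ 2 * (u ^ 2 / v) := by
      have := Nat.ceil_lt_add_one (show 0 ≤ u ^ 2 / v by linarith)
      rw [← hs] at this
      linarith
    have e1 : v ^ 3 / s ≤ v ^ 4 / u ^ 2 := by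
      calc v ^ 3 / s ≤ v ^ 3 / (u ^ 2 / v) := by gcongr
        _ = v ^ 4 / u ^ 2 := by field_simp
    have e2 : u ^ 3 * v ^ 3 ≤ u ^ 4 * v ^ 4 := by
      gcongr <;> first | assumption | norm_num
    have h1 : u ^ 6 * v ^ 6 ≤ D * (20 * (u ^ 4 * v ^ 4) + 4 * u ^ 6) := by
      calc u ^ 6 * v ^ 6 ≤ _ := hR s hs0
        _ ≤ D * (u ^ 6 * (4 * (2 * (v ^ 4 / u ^ 2) + 1)) + 2 * v ^ 6 * (2 * (u ^ 2 / v)) ^ 2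
            + 4 * (u ^ 4 * v ^ 4)) := by gcongr
        _ = D * (20 * (u ^ 4 * v ^ 4) + 4 * u ^ 6) := by field_simp; ring
    rcases le_total (u ^ 2) (v ^ 4) with huv' | huv'
    · have h2 : (u ^ 4 * v ^ 4) * (u ^ 2 * v ^ 2) ≤ (u ^ 4 * v ^ 4) * (D * 24) := by
        have h3 : u ^ 6 ≤ u ^ 4 * v ^ 4 := by
          calc u ^ 6 = u ^ 4 * u ^ 2 := by ring
            _ ≤ _ := by gcongr
        have := mul_le_mul_of_nonneg_left h3 hD
        linarith
      have h4 := le_of_mul_le_mul_left h2 (by positivity)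
      have h5 := min_le_left (u ^ 2 * v ^ 2) (min ((u ^ 3) ^ 2) ((v ^ 3) ^ 2))
      linarith
    · have h2 : u ^ 6 * v ^ 6 ≤ u ^ 6 * (D * 24) := by
        have h3 : u ^ 4 * v ^ 4 ≤ u ^ 6 := by
          calc u ^ 4 * v ^ 4 ≤ u ^ 4 * u ^ 2 := by gcongr
            _ = u ^ 6 := by ring
        have := mul_le_mul_of_nonneg_left h3 hD
        linarith
      have h4 := le_of_mul_le_mul_left h2 (by positivity)
      have h5 : min (u ^ 2 * v ^ 2) (min ((u ^ 3) ^ 2) ((v ^ 3) ^ 2)) ≤ v ^ 6 :=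
        (min_le_right _ _).trans ((min_le_right _ _).trans (by rw [← pow_mul]))
      linarith

/-- Two nonparallel lines in the plane meet. -/
lemma exists_line_inter (o₁ v₁ o₂ v₂ : EuclideanSpace ℝ (Fin 2)) (h₁ : v₁ ≠ 0)
    (h : ¬ ∃ r : ℝ, v₂ = r • v₁) : ∃ s t : ℝ, o₁ + s • v₁ = o₂ + t • v₂ := by
  have hd : v₁ 0 * v₂ 1 - v₁ 1 * v₂ 0 ≠ 0 := by
    intro hd
    by_cases h0 : v₁ 0 = 0
    · have h1 : v₁ 1 ≠ 0 := by
        intro h1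
        apply h₁
        ext i
        fin_cases i <;> simp [h0, h1]
      refine h ⟨v₂ 1 / v₁ 1, ?_⟩
      ext i
      fin_cases i
      · have : v₂ 0 = 0 := by simpa [h0, h1] using hd
        simp [h0, this]
      · simp [h1]
    · refine h ⟨v₂ 0 / v₁ 0, ?_⟩
      ext i
      fin_cases i
      · simp [h0]
      · simp
        field_simp
        linarith
  obtain ⟨i, hi⟩ : ∃ i, (v₁ 0 * v₂ 1 - v₁ 1 * v₂ 0) * i = 1 := ⟨_, mul_inv_cancel₀ hd⟩
  refine ⟨((o₂ 0 - o₁ 0) * v₂ 1 - (o₂ 1 - o₁ 1) * v₂ 0) * i,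
    ((o₂ 0 - o₁ 0) * v₁ 1 - (o₂ 1 - o₁ 1) * v₁ 0) * i, ?_⟩
  ext j
  fin_cases j
  · simp only [Fin.zero_eta, PiLp.add_apply, PiLp.smul_apply, smul_eq_mul]
    linear_combination (o₂ 0 - o₁ 0) * hi
  · simp only [Fin.mk_one, PiLp.add_apply, PiLp.smul_apply, smul_eq_mul]
    linear_combination (o₂ 1 - o₁ 1) * hi

/-- Points on a line through `o` with direction `v` are recovered from their signed distance
to `o`. -/
lemma eq_signedDist_smul {E : Type*} [NormedAddCommGroup E] [InnerProductSpace ℝ E] {o v p : E}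
    (hv : v ≠ 0) (hp : ∃ t : ℝ, p = o + t • v) :
    p = o + (⟪v, p - o⟫ / ‖v‖) • (‖v‖⁻¹ • v) := by
  obtain ⟨t, rfl⟩ := hp
  have : ‖v‖ ≠ 0 := norm_ne_zero_iff.2 hv
  rw [add_sub_cancel_left, inner_smul_right, real_inner_self_eq_norm_sq, smul_smul]
  congr 2
  field_simp

/-- **Theorem 1.1** (Sharir–Sheffer–Solymosi). If `P₁` lies on a line `ℓ₁`, `P₂` lies on a
line `ℓ₂`, and the two lines are neither parallel nor orthogonal, then the number of distinct
distances between `P₁` and `P₂` is `Ω(min{n^{2/3} m^{2/3}, n², m²})`. -/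
theorem distinct_distances_two_lines :
    ∃ c : ℝ, 0 < c ∧
      ∀ (P₁ P₂ : Finset (EuclideanSpace ℝ (Fin 2)))
        (o₁ v₁ o₂ v₂ : EuclideanSpace ℝ (Fin 2)) (n m : ℕ),
        P₁.card = n → P₂.card = m →
        v₁ ≠ 0 → v₂ ≠ 0 →
        (∀ p ∈ P₁, ∃ t : ℝ, p = o₁ + t • v₁) →
        (∀ p ∈ P₂, ∃ t : ℝ, p = o₂ + t • v₂) →
        (¬ ∃ r : ℝ, v₂ = r • v₁) →
        ⟪v₁, v₂⟫ ≠ (0 : ℝ) →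
        c * min ((n : ℝ) ^ (2/3 : ℝ) * (m : ℝ) ^ (2/3 : ℝ))
            (min ((n : ℝ) ^ 2) ((m : ℝ) ^ 2))
          ≤ ((P₁ ×ˢ P₂).image (fun pq => dist pq.1 pq.2)).card := by
  refine ⟨1 / 24, by norm_num, ?_⟩
  intro P₁ P₂ o₁ v₁ o₂ v₂ n m hn hm hv₁ hv₂ hP₁ hP₂ hpar horth
  obtain ⟨s, t, hst⟩ := exists_line_inter o₁ v₁ o₂ v₂ hv₁ hpar
  set o := o₁ + s • v₁ with ho
  have hN₁ : ‖v₁‖ ≠ 0 := norm_ne_zero_iff.2 hv₁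
  have hN₂ : ‖v₂‖ ≠ 0 := norm_ne_zero_iff.2 hv₂
  set l : ℝ := ⟪v₁, v₂⟫ / (‖v₁‖ * ‖v₂‖) with hl
  have hl0 : l ≠ 0 := div_ne_zero horth (mul_ne_zero hN₁ hN₂)
  have hl1 : l ^ 2 ≠ 1 := by
    intro h
    have habs : |l| = 1 :=
      (pow_eq_one_iff_of_nonneg (abs_nonneg l) two_ne_zero).1 ((sq_abs l).trans h)
    obtain ⟨-, r, -, hr⟩ := abs_real_inner_div_norm_mul_norm_eq_one_iff v₁ v₂ |>.1 habs
    exact hpar ⟨r, hr⟩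
  set x₁ : EuclideanSpace ℝ (Fin 2) → ℝ := fun p => ⟪v₁, p - o⟫ / ‖v₁‖ with hx₁
  set x₂ : EuclideanSpace ℝ (Fin 2) → ℝ := fun p => ⟪v₂, p - o⟫ / ‖v₂‖ with hx₂
  have r₁ : ∀ p ∈ P₁, p = o + x₁ p • (‖v₁‖⁻¹ • v₁) := by
    intro p hp
    obtain ⟨t', ht'⟩ := hP₁ p hp
    refine eq_signedDist_smul hv₁ ⟨t' - s, ?_⟩
    rw [ht', ho]
    module
  have r₂ : ∀ p ∈ P₂, p = o + x₂ p • (‖v₂‖⁻¹ • v₂) := by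
    intro p hp
    obtain ⟨t', ht'⟩ := hP₂ p hp
    refine eq_signedDist_smul hv₂ ⟨t' - t, ?_⟩
    rw [ht', hst]
    module
  have i₁ : Set.InjOn x₁ P₁ := fun p hp q hq h => by rw [r₁ p hp, r₁ q hq, h]
  have i₂ : Set.InjOn x₂ P₂ := fun p hp q hq h => by rw [r₂ p hp, r₂ q hq, h]
  have hdist : ∀ p ∈ P₁, ∀ q ∈ P₂, dist p q ^ 2 = sqDistForm l (x₁ p) (x₂ q) := by
    intro p hp q hq
    nth_rewrite 1 [r₁ p hp, r₂ q hq]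
    rw [dist_add_left, dist_eq_norm, norm_sub_sq_real, norm_smul, norm_smul, norm_smul,
      norm_smul, real_inner_smul_left, real_inner_smul_left, real_inner_smul_right,
      real_inner_smul_right, norm_inv, norm_inv, norm_norm, norm_norm, inv_mul_cancel₀ hN₁,
      inv_mul_cancel₀ hN₂, mul_one, mul_one, Real.norm_eq_abs, Real.norm_eq_abs, sq_abs, sq_abs,
      sqDistForm, hl]
    field_simp
    ring
  have himage : ((P₁.image x₁ ×ˢ P₂.image x₂).image (fun z => sqDistForm l z.1 z.2)).card
      ≤ ((P₁ ×ˢ P₂).image (fun pq => dist pq.1 pq.2)).card := by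
    refine (Finset.card_le_card fun d hd => ?_).trans
      (Finset.card_image_le (f := fun d : ℝ => d ^ 2))
    simp only [Finset.mem_image, Finset.mem_product, Prod.exists] at hd ⊢
    obtain ⟨_, _, ⟨⟨p, hp, rfl⟩, q, hq, rfl⟩, rfl⟩ := hd
    exact ⟨_, ⟨p, q, ⟨hp, hq⟩, rfl⟩, hdist p hp q hq⟩
  refine (min_le_of_forall_card_bound fun s hs => ?_).trans (Nat.cast_le.2 himage)
  have := card_mul_sq_le hl0 hl1 (P₁.image x₁) (P₂.image x₂) hs
  rwa [Finset.card_image_of_injOn i₁, Finset.card_image_of_injOn i₂, hn, hm] at this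
end

section
/- Let P₁ and P₂ be finite sets of points in ℝ², each of cardinality m, such that all points of P₁ lie on a line ℓ₁, all points of P₂ lie on a line ℓ₂, and ℓ₁ and ℓ₂ are neither parallel nor orthogonal. Then D(P₁,P₂) = Ω(m^{4/3}); that is, there exists an absolute constant c > 0 such that D(P₁,P₂) ≥ c · m^{4/3}. -/
open scoped Classical RealInnerProductSpace

/-- The squared distance between the points with coordinates `x.1` and `x.2` on two lines through
the origin which make an angle with cosine `l`. -/
def lineSqDist (l : ℝ) (x : ℝ × ℝ) : ℝ := x.1 ^ 2 + x.2 ^ 2 - 2 * l * x.1 * x.2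

/-- The number of pairs with the same image is the sum of the squares of the fibre sizes. -/
theorem card_collisions_eq_sum_sq {α β : Type*} (G : Finset α) (I : Finset β) (F : α → β)
    (h : ∀ w ∈ G, F w ∈ I) :
    ((G ×ˢ G).filter (fun w => F w.1 = F w.2)).card
      = ∑ i ∈ I, (G.filter (fun x => F x = i)).card ^ 2 := by
  rw [Finset.card_eq_sum_card_fiberwise (f := fun w => F w.1) (t := I)]
  · refine Finset.sum_congr rfl fun i _ => ?_
    rw [sq, ← Finset.card_product]
    congr 1
    ext ⟨x, y⟩
    simp only [Finset.mem_filter, Finset.mem_product]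
    grind
  · intro w hw
    exact h _ (Finset.mem_product.1 (Finset.mem_filter.1 hw).1).1

/-- The number of ordered pairs of distinct elements with the same image is at least the number of
elements minus the number of possible images. -/
theorem card_le_card_collisions_add {α β : Type*} (W : Finset α) (I : Finset β) (φ : α → β)
    (h : ∀ w ∈ W, φ w ∈ I) :
    W.card ≤ ((W ×ˢ W).filter (fun w => w.1 ≠ w.2 ∧ φ w.1 = φ w.2)).card + I.card := by
  have hsub : (W ×ˢ W).filter (fun w => φ w.1 = φ w.2) ⊆
      (W ×ˢ W).filter (fun w => w.1 ≠ w.2 ∧ φ w.1 = φ w.2) ∪ W.image (fun x => (x, x)) := by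
    rintro ⟨x, y⟩ hw
    simp only [Finset.mem_filter, Finset.mem_product] at hw
    simp only [Finset.mem_union, Finset.mem_filter, Finset.mem_product, Finset.mem_image]
    by_cases hxy : x = y
    · exact Or.inr ⟨x, hw.1.1, by rw [hxy]⟩
    · exact Or.inl ⟨hw.1, hxy, hw.2⟩
  have hle := (Finset.card_le_card hsub).trans (Finset.card_union_le _ _)
  have hdiag : (W.image (fun x => (x, x))).card ≤ W.card := Finset.card_image_le
  have hlower : 2 * W.card ≤ ((W ×ˢ W).filter (fun w => φ w.1 = φ w.2)).card + I.card := by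
    rw [card_collisions_eq_sum_sq W I φ h, Finset.card_eq_sum_card_fiberwise h, Finset.mul_sum,
      Finset.card_eq_sum_ones I, ← Finset.sum_add_distrib]
    refine Finset.sum_le_sum fun i _ => ?_
    zify
    nlinarith [sq_nonneg (((W.filter (fun x => φ x = i)).card : ℤ) - 1)]
  omega

/-- Cauchy–Schwarz: a lower bound for the number of pairs with the same image. -/
theorem sq_card_le_card_image_mul_collisions {α β : Type*} (G : Finset α) (F : α → β) :
    G.card ^ 2 ≤ (G.image F).card * ((G ×ˢ G).filter (fun w => F w.1 = F w.2)).card := by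
  rw [card_collisions_eq_sum_sq G (G.image F) F fun _ => Finset.mem_image_of_mem F,
    Finset.card_eq_sum_card_image F G]
  exact sq_sum_le_card_mul_sum_sq

/-- A finite set of reals splits into consecutive blocks of at most `s` elements. -/
theorem exists_block_function (B : Finset ℝ) (m s : ℕ) (hs : 0 < s) (hB : B.card ≤ m) :
    ∃ β : ℝ → ℕ, Monotone β ∧ (∀ b ∈ B, β b ≤ m / s) ∧
      ((B ×ˢ B).filter (fun x => β x.1 = β x.2)).card ≤ m * s := by
  set ρ : ℝ → ℕ := fun b => (B.filter (· < b)).card with hρ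
  have hmono : Monotone ρ := fun x y hxy =>
    Finset.card_le_card (Finset.monotone_filter_right _ fun z _ hz => lt_of_lt_of_le hz hxy)
  have hstrict : ∀ x ∈ B, ∀ y, x < y → ρ x < ρ y := by
    intro x hx y hxy
    refine Finset.card_lt_card (Finset.ssubset_iff_of_subset ?_ |>.2 ⟨x, ?_, ?_⟩)
    · exact Finset.monotone_filter_right _ fun z _ hz => lt_trans hz hxy
    · simp [hx, hxy]
    · simp
  have hinj : Set.InjOn ρ B := by
    intro x hx y hy hxy
    rcases lt_trichotomy x y with h | h | h
    · exact absurd hxy (hstrict x hx y h).ne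
    · exact h
    · exact absurd hxy (hstrict y hy x h).ne'
  refine ⟨fun b => ρ b / s, fun x y hxy => Nat.div_le_div_right (hmono hxy), fun b _ => ?_, ?_⟩
  · exact Nat.div_le_div_right ((Finset.card_filter_le _ _).trans hB)
  · have key : ((B ×ˢ B).filter (fun x => ρ x.1 / s = ρ x.2 / s)).card ≤ s * B.card := by
      refine Finset.card_le_mul_card_image_of_maps_to (f := Prod.fst) ?_ s ?_
      · intro x hx
        simp only [Finset.mem_filter, Finset.mem_product] at hx
        exact hx.1.1
      · intro b _
        refine le_of_le_of_eq ?_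
          (show (Finset.Ico (ρ b / s * s) (ρ b / s * s + s)).card = s by simp)
        refine Finset.card_le_card_of_injOn (fun x => ρ x.2) ?_ ?_
        · rintro ⟨x, y⟩ hx
          simp only [Finset.coe_filter, Finset.mem_filter, Finset.mem_product,
            Set.mem_ofPred_eq] at hx
          obtain ⟨⟨_, h1⟩, rfl⟩ := hx
          simp only [Finset.coe_Ico, Set.mem_Ico]
          rw [h1]
          have := Nat.div_add_mod (ρ y) s
          have := Nat.mod_lt (ρ y) hs
          rw [Nat.mul_comm]
          constructor <;> omega
        · rintro ⟨x, y⟩ hx ⟨x', y'⟩ hx' h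
          simp only [Finset.coe_filter, Finset.mem_filter, Finset.mem_product,
            Set.mem_ofPred_eq] at hx hx'
          have := hinj (Finset.mem_coe.2 hx.1.1.2) (Finset.mem_coe.2 hx'.1.1.2) h
          simp only [Prod.mk.injEq]
          exact ⟨hx.2.trans hx'.2.symm, this⟩
    calc _ ≤ s * B.card := key
      _ ≤ s * m := Nat.mul_le_mul_left _ hB
      _ = m * s := Nat.mul_comm _ _

/-- Two pairs of points `b ≠ b'` and `q ≠ q'`, ordered in the same way, determine at most two pairs
`a ≠ p` such that `a` sees `b, b'` at the same distances as `p` sees `q, q'`. -/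
theorem not_three_solutions {l b b' q q' a₁ a₂ a₃ p₁ p₂ p₃ : ℝ} (hl : l ≠ 0) (hl1 : l ^ 2 ≠ 1)
    (hpos : 0 < (b - b') * (q - q'))
    (h1 : lineSqDist l (a₁, b) = lineSqDist l (p₁, q))
    (h1' : lineSqDist l (a₁, b') = lineSqDist l (p₁, q'))
    (h2 : lineSqDist l (a₂, b) = lineSqDist l (p₂, q))
    (h2' : lineSqDist l (a₂, b') = lineSqDist l (p₂, q'))
    (h3 : lineSqDist l (a₃, b) = lineSqDist l (p₃, q))
    (h3' : lineSqDist l (a₃, b') = lineSqDist l (p₃, q'))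
    (hap : a₁ ≠ p₁) (h12 : (a₁, p₁) ≠ (a₂, p₂)) (h13 : (a₁, p₁) ≠ (a₃, p₃))
    (h23 : (a₂, p₂) ≠ (a₃, p₃)) : False := by
  simp only [lineSqDist] at *
  have hk : q - q' ≠ 0 := right_ne_zero_of_mul hpos.ne'
  have hh : b - b' ≠ 0 := left_ne_zero_of_mul hpos.ne'
  have e12 : (p₁ - p₂) * (q - q') = (a₁ - a₂) * (b - b') :=
    mul_left_cancel₀ hl (by linear_combination (h1 - h1' - h2 + h2') / 2)
  have e13 : (p₁ - p₃) * (q - q') = (a₁ - a₃) * (b - b') :=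
    mul_left_cancel₀ hl (by linear_combination (h1 - h1' - h3 + h3') / 2)
  have n12 : a₁ - a₂ ≠ 0 := by
    intro h
    rw [h, zero_mul] at e12
    exact h12 (Prod.ext (sub_eq_zero.1 h)
      (sub_eq_zero.1 ((mul_eq_zero.1 e12).resolve_right hk)))
  have n13 : a₁ - a₃ ≠ 0 := by
    intro h
    rw [h, zero_mul] at e13
    exact h13 (Prod.ext (sub_eq_zero.1 h)
      (sub_eq_zero.1 ((mul_eq_zero.1 e13).resolve_right hk)))
  have n23 : a₂ - a₃ ≠ 0 := by
    intro h
    have : (p₂ - p₃) * (q - q') = 0 := by linear_combination e13 - e12 + h * (b - b')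
    exact h23 (Prod.ext (sub_eq_zero.1 h)
      (sub_eq_zero.1 ((mul_eq_zero.1 this).resolve_right hk)))
  have s12 : (q - q') * (a₁ + a₂ - 2 * l * b) = (b - b') * (p₁ + p₂ - 2 * l * q) :=
    mul_left_cancel₀ n12 (by
      linear_combination (q - q') * (h1 - h2) + (p₁ + p₂ - 2 * l * q) * e12)
  have s13 : (q - q') * (a₁ + a₃ - 2 * l * b) = (b - b') * (p₁ + p₃ - 2 * l * q) :=
    mul_left_cancel₀ n13 (by
      linear_combination (q - q') * (h1 - h3) + (p₁ + p₃ - 2 * l * q) * e13)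
  have hsq : (q - q') ^ 2 = (b - b') ^ 2 :=
    mul_left_cancel₀ n23 (by
      linear_combination (q - q') * (s12 - s13) + (b - b') * (e13 - e12))
  have heq : q - q' = b - b' := by
    rcases sq_eq_sq_iff_eq_or_eq_neg.1 hsq with h | h
    · exact h
    · rw [h] at hpos
      nlinarith [sq_nonneg (b - b')]
  rw [heq] at e12 s12
  have e12' := mul_right_cancel₀ hh e12
  have s12' := mul_left_cancel₀ hh s12
  have hd : l * (p₁ - a₁) = q - b :=
    mul_left_cancel₀ hh (by
      linear_combination (h1 - h1') / 2 + (q - l * p₁ - (b - b' + (q - q')) / 2) * heq)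
  have hz : (1 - l ^ 2) * (a₁ - p₁) = 0 := by
    linear_combination s12' / 2 - e12' / 2 + l * hd
  rcases mul_eq_zero.1 hz with h | h
  · exact hl1 (by linarith)
  · exact hap (sub_eq_zero.1 h)

theorem lineSqDist_strictMono {l a b b' : ℝ} (h : l * a ≤ b) (hb : b < b') :
    lineSqDist l (a, b) < lineSqDist l (a, b') := by
  simp only [lineSqDist]
  nlinarith

theorem le_of_lineSqDist_eq {l a p b b' q q' : ℝ} (hb' : l * a ≤ b') (hq : l * p ≤ q)
    (h : lineSqDist l (a, b) = lineSqDist l (p, q))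
    (h' : lineSqDist l (a, b') = lineSqDist l (p, q')) (hqq : q < q') : b < b' := by
  by_contra! hle
  have h1 := lineSqDist_strictMono hq hqq
  rcases hle.lt_or_eq with h2 | h2
  · have := lineSqDist_strictMono hb' h2
    linarith
  · subst h2
    linarith

theorem card_collisions_le {l : ℝ} (hl : l ≠ 0) (hl1 : l ^ 2 ≠ 1) (A B : Finset ℝ) (m s : ℕ)
    (hs : 0 < s) (hA : A.card ≤ m) (hB : B.card ≤ m) (G : Finset (ℝ × ℝ)) (hG : G ⊆ A ×ˢ B)
    (hGl : ∀ x ∈ G, l * x.1 ≤ x.2) :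
    ((G ×ˢ G).filter
        (fun w => lineSqDist l w.1 = lineSqDist l w.2 ∧ w.1.1 ≠ w.2.1)).card
      ≤ 2 * (m * s) ^ 2 + m ^ 2 * (2 * (m / s) + 1) := by
  obtain ⟨β, hβm, hβB, hβc⟩ := exists_block_function B m s hs hB
  set W := (G ×ˢ G).filter
    (fun w => lineSqDist l w.1 = lineSqDist l w.2 ∧ w.1.1 ≠ w.2.1) with hW
  have memW : ∀ w ∈ W, w.1.1 ∈ A ∧ w.1.2 ∈ B ∧ w.2.1 ∈ A ∧ w.2.2 ∈ B ∧ l * w.1.1 ≤ w.1.2 ∧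
      l * w.2.1 ≤ w.2.2 ∧ lineSqDist l (w.1.1, w.1.2) = lineSqDist l (w.2.1, w.2.2) ∧
      w.1.1 ≠ w.2.1 := by
    intro w hw
    simp only [hW, Finset.mem_filter, Finset.mem_product] at hw
    obtain ⟨⟨h1, h2⟩, h3, h4⟩ := hw
    have g1 := Finset.mem_product.1 (hG h1)
    have g2 := Finset.mem_product.1 (hG h2)
    exact ⟨g1.1, g1.2, g2.1, g2.2, hGl _ h1, hGl _ h2, h3, h4⟩
  set φ : (ℝ × ℝ) × (ℝ × ℝ) → (ℝ × ℝ) × ℕ :=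
    fun w => ((w.1.1, w.2.1), β w.1.2 + β w.2.2) with hφ
  have hcol := card_le_card_collisions_add W ((A ×ˢ A) ×ˢ Finset.range (2 * (m / s) + 1)) φ (by
    intro w hw
    obtain ⟨h1, h2, h3, h4, -⟩ := memW w hw
    have := hβB _ h2
    have := hβB _ h4
    simp only [hφ, Finset.mem_product, Finset.mem_range]
    exact ⟨⟨h1, h3⟩, by omega⟩)
  rw [Finset.card_product, Finset.card_product, Finset.card_range] at hcol
  have hI : A.card * A.card * (2 * (m / s) + 1) ≤ m ^ 2 * (2 * (m / s) + 1) := by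
    rw [sq]
    gcongr
  set T := (W ×ˢ W).filter (fun w => w.1 ≠ w.2 ∧ φ w.1 = φ w.2) with hT
  replace hcol : W.card ≤ T.card + A.card * A.card * (2 * (m / s) + 1) := by convert hcol
  set S := (B ×ˢ B).filter (fun x => β x.1 = β x.2) with hS
  have memT : ∀ t ∈ T, t.1 ∈ W ∧ t.2 ∈ W ∧ t.1.1.1 = t.2.1.1 ∧ t.1.2.1 = t.2.2.1 ∧
      β t.1.1.2 = β t.2.1.2 ∧ β t.1.2.2 = β t.2.2.2 ∧
      0 < (t.1.1.2 - t.2.1.2) * (t.1.2.2 - t.2.2.2) := by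
    rintro ⟨⟨⟨a, b⟩, ⟨p, q⟩⟩, ⟨⟨a', b'⟩, ⟨p', q'⟩⟩⟩ ht
    simp only [hT, hφ, Finset.mem_filter, Finset.mem_product, Prod.mk.injEq] at ht
    obtain ⟨⟨w1, w2⟩, hne, ⟨rfl, rfl⟩, hβ⟩ := ht
    obtain ⟨-, -, -, -, g1, g2, g3, -⟩ := memW _ w1
    obtain ⟨-, -, -, -, k1, k2, k3, -⟩ := memW _ w2
    simp only at g1 g2 g3 k1 k2 k3
    rcases lt_trichotomy q q' with h | h | h
    · have hb := le_of_lineSqDist_eq k1 g2 g3 k3 h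
      have := hβm h.le
      have := hβm hb.le
      exact ⟨w1, w2, rfl, rfl, by simp only; omega, by simp only; omega,
        mul_pos_of_neg_of_neg (sub_neg.2 hb) (sub_neg.2 h)⟩
    · exfalso
      subst h
      rcases lt_trichotomy b b' with h | h | h
      · have := lineSqDist_strictMono g1 h
        linarith
      · subst h
        exact hne rfl
      · have := lineSqDist_strictMono k1 h
        linarith
    · have hb := le_of_lineSqDist_eq g1 k2 k3 g3 h
      have := hβm h.le
      have := hβm hb.le
      exact ⟨w1, w2, rfl, rfl, by simp only; omega, by simp only; omega,
        mul_pos (sub_pos.2 hb) (sub_pos.2 h)⟩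
  have hTS : T.card ≤ 2 * (S ×ˢ S).card := by
    refine Finset.card_le_mul_card_image_of_maps_to
      (f := fun t => ((t.1.1.2, t.2.1.2), (t.1.2.2, t.2.2.2))) ?_ 2 ?_
    · intro t ht
      obtain ⟨w1, w2, -, -, h1, h2, -⟩ := memT t ht
      obtain ⟨-, g1, -, g2, -⟩ := memW _ w1
      obtain ⟨-, k1, -, k2, -⟩ := memW _ w2
      simp only [hS, Finset.mem_product, Finset.mem_filter]
      exact ⟨⟨⟨g1, k1⟩, h1⟩, ⟨⟨g2, k2⟩, h2⟩⟩
    · rintro ⟨⟨b, b'⟩, ⟨q, q'⟩⟩ -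
      by_contra! hcard
      obtain ⟨x, y, z, hx, hy, hz, hxy, hxz, hyz⟩ := Finset.two_lt_card_iff.1 hcard
      have unpack : ∀ t ∈ T.filter (fun t => ((t.1.1.2, t.2.1.2), (t.1.2.2, t.2.2.2))
          = ((b, b'), (q, q'))), ∃ a p, t = (((a, b), (p, q)), ((a, b'), (p, q'))) ∧
          lineSqDist l (a, b) = lineSqDist l (p, q) ∧
          lineSqDist l (a, b') = lineSqDist l (p, q') ∧ a ≠ p ∧
          0 < (b - b') * (q - q') := by
        rintro ⟨⟨⟨a, b₁⟩, ⟨p, q₁⟩⟩, ⟨⟨a', b₁'⟩, ⟨p', q₁'⟩⟩⟩ ht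
        simp only [Finset.mem_filter, Prod.mk.injEq] at ht
        obtain ⟨ht, ⟨rfl, rfl⟩, rfl, rfl⟩ := ht
        obtain ⟨w1, w2, h1, h2, -, -, h3⟩ := memT _ ht
        simp only at h1 h2 h3
        subst h1 h2
        obtain ⟨-, -, -, -, -, -, g, gn⟩ := memW _ w1
        obtain ⟨-, -, -, -, -, -, k, -⟩ := memW _ w2
        exact ⟨a, p, rfl, g, k, gn, h3⟩
      obtain ⟨a₁, p₁, rfl, h1, h1', hn, hpos⟩ := unpack x hx
      obtain ⟨a₂, p₂, rfl, h2, h2', -, -⟩ := unpack y hy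
      obtain ⟨a₃, p₃, rfl, h3, h3', -, -⟩ := unpack z hz
      refine not_three_solutions hl hl1 hpos h1 h1' h2 h2' h3 h3' hn ?_ ?_ ?_
      · rintro ⟨⟩; exact hxy rfl
      · rintro ⟨⟩; exact hxz rfl
      · rintro ⟨⟩; exact hyz rfl
  have hSS : (S ×ˢ S).card ≤ (m * s) ^ 2 := by
    rw [Finset.card_product, sq]
    exact Nat.mul_le_mul hβc hβc
  omega

/-- Distinct values of `lineSqDist l` on a set of pairs lying above the critical line. -/
theorem sq_card_le_of_above {l : ℝ} (hl : l ≠ 0) (hl1 : l ^ 2 ≠ 1) (A B : Finset ℝ) (m s : ℕ)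
    (hs : 0 < s) (hA : A.card ≤ m) (hB : B.card ≤ m) (G : Finset (ℝ × ℝ)) (hG : G ⊆ A ×ˢ B)
    (hGl : ∀ x ∈ G, l * x.1 ≤ x.2) :
    G.card ^ 2 ≤ (G.image (lineSqDist l)).card *
      (2 * (m * s) ^ 2 + m ^ 2 * (2 * (m / s) + 1) + m ^ 2) := by
  refine (sq_card_le_card_image_mul_collisions G (lineSqDist l)).trans
    (Nat.mul_le_mul_left _ ?_)
  have hGm : G.card ≤ m ^ 2 := by
    refine (Finset.card_le_card hG).trans ?_
    rw [Finset.card_product, sq]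
    exact Nat.mul_le_mul hA hB
  have hdiag : (G ×ˢ G).filter (fun w => lineSqDist l w.1 = lineSqDist l w.2) ⊆
      (G ×ˢ G).filter (fun w => lineSqDist l w.1 = lineSqDist l w.2 ∧ w.1.1 ≠ w.2.1) ∪
        G.image (fun x => (x, x)) := by
    rintro ⟨⟨a, b⟩, ⟨p, q⟩⟩ hw
    simp only [Finset.mem_filter, Finset.mem_product] at hw
    simp only [Finset.mem_union, Finset.mem_filter, Finset.mem_product, Finset.mem_image]
    obtain ⟨⟨h1, h2⟩, h3⟩ := hw
    by_cases hap : a = p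
    · subst hap
      right
      refine ⟨(a, b), h1, ?_⟩
      rcases lt_trichotomy b q with h | h | h
      · exact absurd h3 (lineSqDist_strictMono (hGl _ h1) h).ne
      · rw [h]
      · exact absurd h3 (lineSqDist_strictMono (hGl _ h2) h).ne'
    · exact Or.inl ⟨⟨h1, h2⟩, h3, hap⟩
  refine (Finset.card_le_card hdiag).trans ((Finset.card_union_le _ _).trans ?_)
  exact Nat.add_le_add (card_collisions_le hl hl1 A B m s hs hA hB G hG hGl)
    (Finset.card_image_le.trans hGm)

theorem pow_four_le_card_image_lineSqDist {l : ℝ} (hl : l ≠ 0) (hl1 : l ^ 2 ≠ 1) (A B : Finset ℝ)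
    (m s : ℕ) (hs : 0 < s) (hA : A.card = m) (hB : B.card = m) :
    m ^ 4 ≤ 4 * (((A ×ˢ B).image (lineSqDist l)).card *
      (2 * (m * s) ^ 2 + m ^ 2 * (2 * (m / s) + 1) + m ^ 2)) := by
  set Gp := (A ×ˢ B).filter (fun x => l * x.1 ≤ x.2) with hGp
  set Gn := (A ×ˢ B).filter (fun x => ¬ l * x.1 ≤ x.2) with hGn
  set K := 2 * (m * s) ^ 2 + m ^ 2 * (2 * (m / s) + 1) + m ^ 2 with hK
  set D := ((A ×ˢ B).image (lineSqDist l)).card with hD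
  have hsum : Gp.card + Gn.card = m ^ 2 := by
    rw [hGp, hGn, Finset.card_filter_add_card_filter_not, Finset.card_product, hA, hB, sq]
  have hp : Gp.card ^ 2 ≤ D * K := by
    refine (sq_card_le_of_above hl hl1 A B m s hs hA.le hB.le Gp (Finset.filter_subset _ _)
      (fun x hx => (Finset.mem_filter.1 hx).2)).trans (Nat.mul_le_mul_right _ ?_)
    exact Finset.card_le_card (Finset.image_subset_image (Finset.filter_subset _ _))
  have hn : Gn.card ^ 2 ≤ D * K := by
    set r : ℝ × ℝ → ℝ × ℝ := fun x => (x.1, -x.2) with hr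
    have hrinj : Function.Injective r := by
      rintro ⟨a, b⟩ ⟨c, d⟩ h
      simpa [hr] using h
    have hrl : ∀ x, lineSqDist (-l) (r x) = lineSqDist l x := by
      intro x
      simp only [lineSqDist, hr]
      ring
    have := sq_card_le_of_above (neg_ne_zero.2 hl) (by rwa [neg_sq]) A (B.image (fun b => -b)) m s
      hs hA.le (Finset.card_image_le.trans hB.le) (Gn.image r) (by
        intro y hy
        obtain ⟨x, hx, rfl⟩ := Finset.mem_image.1 hy
        have := Finset.mem_product.1 (Finset.mem_filter.1 hx).1
        exact Finset.mem_product.2 ⟨this.1, Finset.mem_image_of_mem _ this.2⟩) (by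
        intro y hy
        obtain ⟨x, hx, rfl⟩ := Finset.mem_image.1 hy
        have := (Finset.mem_filter.1 hx).2
        simp only [hr]
        linarith)
    rw [Finset.card_image_of_injective _ hrinj, Finset.image_image] at this
    refine this.trans (Nat.mul_le_mul_right _ (Finset.card_le_card ?_))
    intro y hy
    obtain ⟨x, hx, rfl⟩ := Finset.mem_image.1 hy
    rw [Function.comp_apply, hrl]
    exact Finset.mem_image_of_mem _ (Finset.mem_filter.1 hx).1
  have : m ^ 4 = (Gp.card + Gn.card) ^ 2 := by rw [hsum]; ring
  rw [this]
  zify at hp hn ⊢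
  nlinarith [sq_nonneg ((Gp.card : ℤ) - Gn.card)]

theorem rpow_le_card_image_lineSqDist {l : ℝ} (hl : l ≠ 0) (hl1 : l ^ 2 ≠ 1) (A B : Finset ℝ)
    (m : ℕ) (hA : A.card = m) (hB : B.card = m) :
    1 / 48 * (m : ℝ) ^ (4 / 3 : ℝ) ≤ ((A ×ˢ B).image (lineSqDist l)).card := by
  rcases Nat.eq_zero_or_pos m with rfl | hm
  · rw [Nat.cast_zero, Real.zero_rpow (by norm_num), mul_zero]
    exact Nat.cast_nonneg _
  have hm1 : (1 : ℝ) ≤ m := by exact_mod_cast hm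
  set x : ℝ := (m : ℝ) ^ (1 / 3 : ℝ) with hx
  have hx1 : 1 ≤ x := Real.one_le_rpow hm1 (by norm_num)
  have hx3 : (m : ℝ) = x ^ 3 := by
    rw [hx, ← Real.rpow_natCast, ← Real.rpow_mul (by positivity)]
    norm_num
  have hx4 : (m : ℝ) ^ (4 / 3 : ℝ) = x ^ 4 := by
    rw [hx, ← Real.rpow_natCast, ← Real.rpow_mul (by positivity)]
    norm_num
  have hsx : x ≤ ⌈x⌉₊ := Nat.le_ceil x
  have hsx2 : (⌈x⌉₊ : ℝ) ≤ 2 * x := by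
    have := Nat.ceil_lt_add_one (zero_le_one.trans hx1)
    linarith
  have key := pow_four_le_card_image_lineSqDist hl hl1 A B m ⌈x⌉₊
    (Nat.ceil_pos.2 (by linarith)) hA hB
  set D := ((A ×ˢ B).image (lineSqDist l)).card
  have hdiv : ((m / ⌈x⌉₊ : ℕ) : ℝ) ≤ x ^ 2 := by
    refine Nat.cast_div_le.trans ?_
    rw [div_le_iff₀ (by linarith), hx3]
    nlinarith [sq_nonneg x]
  have hK : (2 * ((m : ℝ) * ⌈x⌉₊) ^ 2 + m ^ 2 * (2 * ((m / ⌈x⌉₊ : ℕ) : ℝ) + 1) + m ^ 2)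
      ≤ 12 * x ^ 8 := by
    have h2 : (⌈x⌉₊ : ℝ) ^ 2 ≤ 4 * x ^ 2 := by nlinarith
    have h3 : (1 : ℝ) ≤ x ^ 2 := by nlinarith
    have h6 : 0 ≤ x ^ 6 := by positivity
    rw [hx3]
    nlinarith [mul_le_mul_of_nonneg_left h2 h6, mul_le_mul_of_nonneg_left h3 h6,
      mul_le_mul_of_nonneg_left hdiv h6]
  have key' : (m : ℝ) ^ 4 ≤ 4 * (D * (2 * ((m : ℝ) * ⌈x⌉₊) ^ 2
      + m ^ 2 * (2 * ((m / ⌈x⌉₊ : ℕ) : ℝ) + 1) + m ^ 2)) := by exact_mod_cast key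
  have h12 : x ^ 4 * x ^ 8 ≤ (48 * D) * x ^ 8 := by
    calc x ^ 4 * x ^ 8 = (m : ℝ) ^ 4 := by rw [hx3]; ring
      _ ≤ _ := key'
      _ ≤ 4 * (D * (12 * x ^ 8)) :=
        mul_le_mul_of_nonneg_left (mul_le_mul_of_nonneg_left hK (Nat.cast_nonneg _)) (by norm_num)
      _ = _ := by ring
  have := le_of_mul_le_mul_right h12 (by positivity)
  rw [hx4]
  linarith

/-- Two lines in the plane with linearly independent directions meet. -/
theorem exists_line_intersection (o₁ v₁ o₂ v₂ : EuclideanSpace ℝ (Fin 2)) (hv : v₁ ≠ 0)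
    (hpar : ¬ ∃ r : ℝ, v₂ = r • v₁) : ∃ s t : ℝ, o₁ + s • v₁ = o₂ + t • v₂ := by
  have hdet : v₁ 0 * v₂ 1 - v₁ 1 * v₂ 0 ≠ 0 := by
    intro h
    by_cases h0 : v₁ 0 = 0
    · have h1 : v₁ 1 ≠ 0 := by
        intro h1
        apply hv
        ext i
        fin_cases i <;> simp [h0, h1]
      refine hpar ⟨v₂ 1 / v₁ 1, ?_⟩
      ext i
      fin_cases i
      · have h2 : v₂ 0 = 0 := by
          rw [h0, zero_mul, zero_sub, neg_eq_zero] at h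
          exact (mul_eq_zero.1 h).resolve_left h1
        change v₂ 0 = v₂ 1 / v₁ 1 * v₁ 0
        rw [h0, h2, mul_zero]
      · simp [h1]
    · refine hpar ⟨v₂ 0 / v₁ 0, ?_⟩
      ext i
      fin_cases i
      · simp [h0]
      · simp
        field_simp
        linarith
  set d := v₁ 0 * v₂ 1 - v₁ 1 * v₂ 0 with hd
  refine ⟨((o₂ 0 - o₁ 0) * v₂ 1 - (o₂ 1 - o₁ 1) * v₂ 0) / d,
    ((o₂ 0 - o₁ 0) * v₁ 1 - (o₂ 1 - o₁ 1) * v₁ 0) / d, ?_⟩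
  ext i
  fin_cases i
  · simp only [Fin.zero_eta, PiLp.add_apply, PiLp.smul_apply, smul_eq_mul]
    field_simp
    rw [hd]
    ring
  · simp only [Fin.mk_one, PiLp.add_apply, PiLp.smul_apply, smul_eq_mul]
    field_simp
    rw [hd]
    ring

theorem dist_sq_eq_lineSqDist {E : Type*} [NormedAddCommGroup E] [InnerProductSpace ℝ E]
    (o v w : E) (hv : v ≠ 0) (hw : w ≠ 0) (x y : ℝ) :
    dist (o + x • v) (o + y • w) ^ 2
      = lineSqDist (⟪v, w⟫ / (‖v‖ * ‖w‖)) (x * ‖v‖, y * ‖w‖) := by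
  have hv' : ‖v‖ ≠ 0 := norm_ne_zero_iff.2 hv
  have hw' : ‖w‖ ≠ 0 := norm_ne_zero_iff.2 hw
  rw [dist_add_left, dist_eq_norm, norm_sub_sq_real, real_inner_smul_left, real_inner_smul_right,
    norm_smul, norm_smul, mul_pow, mul_pow, Real.norm_eq_abs, Real.norm_eq_abs, sq_abs, sq_abs]
  simp only [lineSqDist]
  field_simp
  ring

/-- The coordinates of finitely many points of a line. -/
theorem exists_line_coordinates {E : Type*} [NormedAddCommGroup E] [NormedSpace ℝ E]
    (P : Finset E) (o v : E) (hv : v ≠ 0) (h : ∀ p ∈ P, ∃ t : ℝ, p = o + t • v) :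
    ∃ A : Finset ℝ, A.card = P.card ∧ ∀ x ∈ A, ∃ t : ℝ, o + t • v ∈ P ∧ x = t * ‖v‖ := by
  choose! t ht using h
  refine ⟨P.image (fun p => t p * ‖v‖), Finset.card_image_of_injOn ?_, ?_⟩
  · intro p hp q hq hpq
    rw [ht p hp, ht q hq, mul_right_cancel₀ (norm_ne_zero_iff.2 hv) hpq]
  · intro x hx
    obtain ⟨p, hp, rfl⟩ := Finset.mem_image.1 hx
    exact ⟨t p, by rwa [← ht p hp], rfl⟩

/-- **Corollary 1.2** (balanced case). If `P₁` and `P₂` each have `m` points, lying on two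
lines that are neither parallel nor orthogonal, then `D(P₁,P₂) = Ω(m^{4/3})`. -/
theorem distinct_distances_two_lines_balanced :
    ∃ c : ℝ, 0 < c ∧
      ∀ (P₁ P₂ : Finset (EuclideanSpace ℝ (Fin 2)))
        (o₁ v₁ o₂ v₂ : EuclideanSpace ℝ (Fin 2)) (m : ℕ),
        P₁.card = m → P₂.card = m →
        v₁ ≠ 0 → v₂ ≠ 0 →
        (∀ p ∈ P₁, ∃ t : ℝ, p = o₁ + t • v₁) →
        (∀ p ∈ P₂, ∃ t : ℝ, p = o₂ + t • v₂) →
        (¬ ∃ r : ℝ, v₂ = r • v₁) →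
        ⟪v₁, v₂⟫ ≠ (0 : ℝ) →
        c * (m : ℝ) ^ (4/3 : ℝ)
          ≤ ((P₁ ×ˢ P₂).image (fun pq => dist pq.1 pq.2)).card := by
  refine ⟨1 / 48, by norm_num, ?_⟩
  intro P₁ P₂ o₁ v₁ o₂ v₂ m hP₁ hP₂ hv₁ hv₂ h₁ h₂ hpar horth
  obtain ⟨s, t, hst⟩ := exists_line_intersection o₁ v₁ o₂ v₂ hv₁ hpar
  set o := o₁ + s • v₁ with ho
  obtain ⟨A, hA, hAP⟩ := exists_line_coordinates P₁ o v₁ hv₁ (by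
    intro p hp
    obtain ⟨x, rfl⟩ := h₁ p hp
    exact ⟨x - s, by rw [ho]; module⟩)
  obtain ⟨B, hB, hBP⟩ := exists_line_coordinates P₂ o v₂ hv₂ (by
    intro p hp
    obtain ⟨x, rfl⟩ := h₂ p hp
    exact ⟨x - t, by rw [hst]; module⟩)
  have hn₁ : ‖v₁‖ ≠ 0 := norm_ne_zero_iff.2 hv₁
  have hn₂ : ‖v₂‖ ≠ 0 := norm_ne_zero_iff.2 hv₂
  have hl : ⟪v₁, v₂⟫ / (‖v₁‖ * ‖v₂‖) ≠ 0 := div_ne_zero horth (mul_ne_zero hn₁ hn₂)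
  have hl1 : (⟪v₁, v₂⟫ / (‖v₁‖ * ‖v₂‖)) ^ 2 ≠ 1 := by
    intro h
    rw [← sq_abs, pow_eq_one_iff_of_nonneg (abs_nonneg _) two_ne_zero,
      abs_real_inner_div_norm_mul_norm_eq_one_iff] at h
    obtain ⟨-, r, -, hr⟩ := h
    exact hpar ⟨r, hr⟩
  refine (rpow_le_card_image_lineSqDist hl hl1 A B m (hA.trans hP₁) (hB.trans hP₂)).trans ?_
  refine Nat.cast_le.2 (le_trans (Finset.card_le_card ?_) (Finset.card_image_le (f := (· ^ 2))))
  intro d hd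
  obtain ⟨⟨x, y⟩, hxy, rfl⟩ := Finset.mem_image.1 hd
  rw [Finset.mem_product] at hxy
  obtain ⟨x, hx, rfl⟩ := hAP _ hxy.1
  obtain ⟨y, hy, rfl⟩ := hBP _ hxy.2
  rw [← dist_sq_eq_lineSqDist o v₁ v₂ hv₁ hv₂]
  exact Finset.mem_image_of_mem _
    (Finset.mem_image_of_mem (fun pq => dist pq.1 pq.2) (Finset.mk_mem_product hx hy))
end

section
/- Let s ∈ ℝ with s ≠ 0, s ≠ 1, s ≠ −1. For pairs (a,b) and (a',b') of positive reals with a ≠ b, a' ≠ b', and (a,b) ≠ (a',b'), the curves γ_{a,b} and γ_{a',b'} (zero sets in ℝ² of a² − b² + x² − y² − 2s(ax − by) and of a'² − b'² + x² − y² − 2s(a'x − b'y), respectively) intersect in at most two points of ℝ². -/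
/-- Any two distinct hyperbolas `γ_{a,b}`, `γ_{a',b'}` of the family (with `s ≠ 0, ±1` and
positive parameters `a ≠ b`, `a' ≠ b'`) intersect in at most two points of `ℝ²`. -/
theorem curves_intersect_in_at_most_two_points
    (s : ℝ) (hs0 : s ≠ 0) (hs1 : s ≠ 1) (hs2 : s ≠ -1)
    (a b a' b' : ℝ) (ha : 0 < a) (hb : 0 < b) (ha' : 0 < a') (hb' : 0 < b')
    (hab : a ≠ b) (hab' : a' ≠ b') (hne : (a, b) ≠ (a', b')) :
    ∃ u v : ℝ × ℝ,
      {p : ℝ × ℝ | a ^ 2 - b ^ 2 + p.1 ^ 2 - p.2 ^ 2 - 2 * s * (a * p.1 - b * p.2) = 0} ∩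
      {p : ℝ × ℝ | a' ^ 2 - b' ^ 2 + p.1 ^ 2 - p.2 ^ 2 - 2 * s * (a' * p.1 - b' * p.2) = 0}
        ⊆ {u, v} := by
  have hs : (1 - s) * (1 + s) ≠ 0 :=
    mul_ne_zero (sub_ne_zero.mpr hs1.symm) fun h => hs2 (by linarith)
  have hK : (1 - s) * (1 + s) * ((a - b) * (a + b)) ≠ 0 :=
    mul_ne_zero hs (mul_ne_zero (sub_ne_zero.mpr hab) (by positivity))
  have hN : (a - a') ^ 2 + (b - b') ^ 2 ≠ 0 := by
    intro h
    apply hne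
    ext
    · nlinarith [sq_nonneg (a - a'), sq_nonneg (b - b')]
    · nlinarith [sq_nonneg (a - a'), sq_nonneg (b - b')]
  rcases Set.eq_empty_or_nonempty
    ({p : ℝ × ℝ | a ^ 2 - b ^ 2 + p.1 ^ 2 - p.2 ^ 2 - 2 * s * (a * p.1 - b * p.2) = 0} ∩
      {p : ℝ × ℝ | a' ^ 2 - b' ^ 2 + p.1 ^ 2 - p.2 ^ 2 - 2 * s * (a' * p.1 - b' * p.2) = 0})
    with hS | ⟨⟨x, y⟩, hp, hp'⟩
  · exact ⟨0, 0, hS ▸ Set.empty_subset _⟩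
  simp only [Set.mem_ofPred_eq] at hp hp'
  obtain ⟨c, hc⟩ : ∃ c, c = a - a' := ⟨_, rfl⟩
  obtain ⟨d, hd⟩ : ∃ d, d = b - b' := ⟨_, rfl⟩
  rw [← hc, ← hd] at hN
  obtain ⟨m, hm⟩ : ∃ m, m = 2 * ((x - s * a) * d - (y - s * b) * c) := ⟨_, rfl⟩
  refine ⟨(x, y), (x + -m / (d ^ 2 - c ^ 2) * d, y + -m / (d ^ 2 - c ^ 2) * c), ?_⟩
  rintro ⟨z, w⟩ ⟨hq, hq'⟩
  simp only [Set.mem_ofPred_eq] at hq hq'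
  have hline : c * (z - x) = d * (w - y) := by
    apply mul_left_cancel₀ (mul_ne_zero two_ne_zero hs0)
    subst hc hd
    linear_combination hp - hp' - hq + hq'
  obtain ⟨t, rfl, rfl⟩ : ∃ t, z = x + t * d ∧ w = y + t * c := by
    refine ⟨((z - x) * d + (w - y) * c) / (c ^ 2 + d ^ 2), ?_, ?_⟩
    · field_simp
      linear_combination c * hline
    · field_simp
      linear_combination -d * hline
  have ht : t * (t * (d ^ 2 - c ^ 2) + m) = 0 := by
    subst hm
    linear_combination hq - hp
  rcases mul_eq_zero.mp ht with rfl | ht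
  · simp
  · have hdc : d ^ 2 - c ^ 2 ≠ 0 := by
      intro h
      have hm0 : (x - s * a) * d - (y - s * b) * c = 0 := by
        rw [h] at ht
        linarith
      apply mul_ne_zero hN hK
      -- Here the line is asymptotic, so it would have to be contained in the hyperbola.
      linear_combination (c ^ 2 + d ^ 2) * hp
        - 2 * ((x - s * a) * d + (y - s * b) * c) * hm0
        + ((x - s * a) ^ 2 + (y - s * b) ^ 2) * h
    have : t = -m / (d ^ 2 - c ^ 2) := by
      rw [eq_div_iff hdc]
      linarith
    simp [this]
end

section
/- Let s ∈ ℝ with s ≠ 0, s ≠ 1, s ≠ −1. For a point pair (p,q) ∈ ℝ² with p ≠ q, at most two curves from the family {γ_{a,b} : a, b positive reals, a ≠ b} pass through both points of any given pair of distinct points of the form (p,q), (p',q') with p,q,p',q' positive, p ≠ q, p' ≠ q': i.e., the number of pairs (a,b) with a ≠ b such that both (p,q) and (p',q') lie on γ_{a,b} is at most two. -/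
/-- A set in which any three elements contain a repetition is covered by a pair. -/
theorem exists_subset_pair_of_forall_three {α : Type*} [Nonempty α] {S : Set α}
    (h : ∀ x ∈ S, ∀ y ∈ S, ∀ z ∈ S, x = y ∨ x = z ∨ y = z) : ∃ u v : α, S ⊆ {u, v} := by
  rcases S.eq_empty_or_nonempty with rfl | ⟨u, hu⟩
  · exact ⟨Classical.arbitrary α, Classical.arbitrary α, Set.empty_subset _⟩
  by_cases hv : ∃ v ∈ S, u ≠ v
  · obtain ⟨v, hv, huv⟩ := hv
    refine ⟨u, v, fun z hz => ?_⟩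
    rcases h u hu v hv z hz with h | h | h
    · exact absurd h huv
    · exact Or.inl h.symm
    · exact Or.inr h.symm
  · push Not at hv
    exact ⟨u, u, fun z hz => Or.inl (hv z hz).symm⟩

/-- A vector orthogonal to `(m, -n)` is a multiple of `(n, m)`. -/
theorem exists_eq_mul_of_mul_eq_mul {m n x y : ℝ} (hmn : m ≠ 0 ∨ n ≠ 0) (h : m * x = n * y) :
    ∃ t : ℝ, x = t * n ∧ y = t * m := by
  rcases hmn with hm | hn
  · exact ⟨y / m, by field_simp; linarith, by field_simp⟩
  · exact ⟨x / n, by field_simp, by field_simp; linarith⟩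

/-- A line meets the hyperbola `x ^ 2 - y ^ 2 = k`, `k ≠ 0`, in at most two points. -/
theorem eq_of_mem_line_of_mem_hyperbola {m n c k x₀ y₀ x₁ y₁ x₂ y₂ : ℝ}
    (hmn : m ≠ 0 ∨ n ≠ 0) (hk : k ≠ 0)
    (l₀ : m * x₀ - n * y₀ = c) (l₁ : m * x₁ - n * y₁ = c) (l₂ : m * x₂ - n * y₂ = c)
    (h₀ : x₀ ^ 2 - y₀ ^ 2 = k) (h₁ : x₁ ^ 2 - y₁ ^ 2 = k) (h₂ : x₂ ^ 2 - y₂ ^ 2 = k) :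
    (x₀ = x₁ ∧ y₀ = y₁) ∨ (x₀ = x₂ ∧ y₀ = y₂) ∨ (x₁ = x₂ ∧ y₁ = y₂) := by
  obtain ⟨t, hx₁, hy₁⟩ := exists_eq_mul_of_mul_eq_mul (x := x₁ - x₀) (y := y₁ - y₀) hmn
    (by linarith)
  obtain ⟨r, hx₂, hy₂⟩ := exists_eq_mul_of_mul_eq_mul (x := x₂ - x₀) (y := y₂ - y₀) hmn
    (by linarith)
  obtain rfl : x₁ = x₀ + t * n := by linarith
  obtain rfl : y₁ = y₀ + t * m := by linarith
  obtain rfl : x₂ = x₀ + r * n := by linarith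
  obtain rfl : y₂ = y₀ + r * m := by linarith
  by_cases ht : t = 0
  · left; simp [ht]
  by_cases hr : r = 0
  · right; left; simp [hr]
  by_cases htr : t = r
  · right; right; simp [htr]
  exfalso
  have e₁ : t * (n ^ 2 - m ^ 2) + 2 * (x₀ * n - y₀ * m) = 0 :=
    mul_left_cancel₀ ht (by linear_combination h₁ - h₀)
  have e₂ : r * (n ^ 2 - m ^ 2) + 2 * (x₀ * n - y₀ * m) = 0 :=
    mul_left_cancel₀ hr (by linear_combination h₂ - h₀)
  have hsq : n ^ 2 - m ^ 2 = 0 :=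
    mul_left_cancel₀ (sub_ne_zero.2 htr) (by linear_combination e₁ - e₂)
  have hort : x₀ * n - y₀ * m = 0 := by linear_combination (e₁ - t * hsq) / 2
  have hm : m ^ 2 * k = 0 := by
    linear_combination (-m ^ 2) * h₀ + (x₀ * n + y₀ * m) * hort - x₀ ^ 2 * hsq
  have hm0 : m = 0 := by simpa [hk] using hm
  have hn0 : n = 0 := by simpa [hm0] using hsq
  exact hmn.elim (· hm0) (· hn0)


/-- Dual statement: for `s ≠ 0, ±1` and two distinct points `(p,q) ≠ (p',q')` with positive
coordinates and `p ≠ q`, `p' ≠ q'`, at most two parameter pairs `(a,b)` (with `a,b > 0`,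
`a ≠ b`) yield a curve `γ_{a,b}` passing through both points. -/
theorem at_most_two_curves_through_two_points
    (s : ℝ) (hs0 : s ≠ 0) (hs1 : s ≠ 1) (hs2 : s ≠ -1)
    (p q p' q' : ℝ) (hp : 0 < p) (hq : 0 < q) (hp' : 0 < p') (hq' : 0 < q')
    (hpq : p ≠ q) (hpq' : p' ≠ q') (hne : (p, q) ≠ (p', q')) :
    ∃ u v : ℝ × ℝ,
      {ab : ℝ × ℝ | 0 < ab.1 ∧ 0 < ab.2 ∧ ab.1 ≠ ab.2 ∧
        ab.1 ^ 2 - ab.2 ^ 2 + p ^ 2 - q ^ 2 - 2 * s * (ab.1 * p - ab.2 * q) = 0 ∧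
        ab.1 ^ 2 - ab.2 ^ 2 + p' ^ 2 - q' ^ 2 - 2 * s * (ab.1 * p' - ab.2 * q') = 0}
        ⊆ {u, v} := by
  refine exists_subset_pair_of_forall_three ?_
  rintro ⟨a₀, b₀⟩ ⟨-, -, -, h₀, h₀'⟩ ⟨a₁, b₁⟩ ⟨-, -, -, h₁, h₁'⟩ ⟨a₂, b₂⟩ ⟨-, -, -, h₂, h₂'⟩
  dsimp only at h₀ h₀' h₁ h₁' h₂ h₂'
  have hmn : 2 * s * (p - p') ≠ 0 ∨ 2 * s * (q - q') ≠ 0 := by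
    by_contra! h
    simp only [mul_eq_zero, OfNat.ofNat_ne_zero, hs0, false_or, sub_eq_zero] at h
    exact hne (Prod.ext h.1 h.2)
  have hk : (s - 1) * (s + 1) * ((p - q) * (p + q)) ≠ 0 :=
    mul_ne_zero (mul_ne_zero (sub_ne_zero.2 hs1) fun h => hs2 (by linarith))
      (mul_ne_zero (sub_ne_zero.2 hpq) (by positivity))
  have key := eq_of_mem_line_of_mem_hyperbola
    (c := p ^ 2 - q ^ 2 - p' ^ 2 + q' ^ 2
      - 2 * s * (p - p') * (s * p) + 2 * s * (q - q') * (s * q))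
    (x₀ := a₀ - s * p) (y₀ := b₀ - s * q) (x₁ := a₁ - s * p) (y₁ := b₁ - s * q)
    (x₂ := a₂ - s * p) (y₂ := b₂ - s * q) hmn hk
    (by linear_combination h₀' - h₀) (by linear_combination h₁' - h₁)
    (by linear_combination h₂' - h₂) (by linear_combination h₀)
    (by linear_combination h₁) (by linear_combination h₂)
  simpa only [sub_left_inj, Prod.mk.injEq] using key
end

section
/- Let P₁ and P₂ be finite sets of points in ℝ² with |P₁| = n ≥ |P₂| = m, such that all points of P₁ lie on a line ℓ₁, all points of P₂ lie on a line ℓ₂, and ℓ₁ and ℓ₂ are neither parallel nor orthogonal. Let Q be the set of ordered quadruples (a,p,b,q) with a,b ∈ P₁, p,q ∈ P₂, dist(a,p) = dist(b,q) > 0 and (a,p) ≠ (b,q). Then there is an absolute constant C such that |Q| ≤ C(m^{4/3} n^{4/3} + n²). -/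
open scoped Classical RealInnerProductSpace

/-- A finite set has at most as many elements as its image under `κ`, plus the number of ordered
pairs of distinct elements in a common fibre of `κ`. -/
lemma card_le_card_image_add_card_offDiag {α γ : Type*} [DecidableEq γ] (S : Finset α) (κ : α → γ) :
    S.card ≤ (S.image κ).card + (S.offDiag.filter fun z => κ z.1 = κ z.2).card := by
  induction S using Finset.induction_on with
  | empty => simp
  | insert a S ha ih =>
    rw [Finset.card_insert_of_notMem ha]
    have hsub : (S.offDiag.filter fun z => κ z.1 = κ z.2) ⊆
        ((insert a S).offDiag.filter fun z => κ z.1 = κ z.2) :=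
      Finset.filter_subset_filter _ (Finset.offDiag_mono (Finset.subset_insert a S))
    by_cases hκ : κ a ∈ S.image κ
    · obtain ⟨b, hb, hab⟩ := Finset.mem_image.1 hκ
      have hlt := Finset.card_lt_card (Finset.ssubset_iff_subset_ne.2 ⟨hsub, fun h => by
        have : (a, b) ∈ ((insert a S).offDiag.filter fun z => κ z.1 = κ z.2) := by
          simp only [Finset.mem_filter, Finset.mem_offDiag, Finset.mem_insert]
          exact ⟨⟨Or.inl trivial, Or.inr hb, fun h => ha (h ▸ hb)⟩, hab.symm⟩
        rw [← h] at this
        exact ha (Finset.mem_offDiag.1 (Finset.mem_filter.1 this).1).1⟩)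
      rw [Finset.image_insert, Finset.insert_eq_of_mem hκ]
      omega
    · have hle := Finset.card_le_card hsub
      rw [Finset.image_insert, Finset.card_insert_of_notMem hκ]
      omega

/-- Incidence bound by partitioning: points are distributed into the cells given by `κ`, every
curve meets at most `D` cells, every cell has at most `T` points and two distinct points lie on at
most `k` common curves. -/
lemma card_incidences_le_s11 {α β γ : Type*} [DecidableEq γ] (P : Finset α) (L : Finset β) (I : α → β → Prop)
    (κ : α → γ) (D T k : ℕ)
    (hD : ∀ l ∈ L, ((P.filter (I · l)).image κ).card ≤ D)
    (hk : ∀ p ∈ P, ∀ p' ∈ P, p ≠ p' → (L.filter fun l => I p l ∧ I p' l).card ≤ k)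
    (hT : ∀ p ∈ P, (P.filter fun p' => κ p = κ p').card ≤ T) :
    ((P ×ˢ L).filter fun z => I z.1 z.2).card ≤ D * L.card + k * (T * P.card) := by
  set R : Finset (α × α) := P.offDiag.filter fun z => κ z.1 = κ z.2 with hR
  have hcount : ((P ×ˢ L).filter fun z => I z.1 z.2).card =
      ∑ l ∈ L, (P.filter (I · l)).card := by
    simp only [Finset.card_filter]
    rw [Finset.sum_product_right]
  have hcurve : ∀ l ∈ L, (P.filter (I · l)).card ≤
      D + (R.filter fun z => I z.1 l ∧ I z.2 l).card := by
    intro l hl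
    refine (card_le_card_image_add_card_offDiag _ κ).trans (add_le_add (hD l hl) ?_)
    refine Finset.card_le_card fun z hz => ?_
    simp only [hR, Finset.mem_filter, Finset.mem_offDiag] at hz ⊢
    tauto
  have hpairs : ∑ l ∈ L, (R.filter fun z => I z.1 l ∧ I z.2 l).card ≤ k * R.card := by
    have hswap : ∑ l ∈ L, (R.filter fun z => I z.1 l ∧ I z.2 l).card =
        ∑ z ∈ R, (L.filter fun l => I z.1 l ∧ I z.2 l).card := by
      simp only [Finset.card_filter]
      rw [Finset.sum_comm]
    rw [hswap, mul_comm]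
    refine Finset.sum_le_card_nsmul _ _ _ fun z hz => ?_
    simp only [hR, Finset.mem_filter, Finset.mem_offDiag] at hz
    exact hk _ hz.1.1 _ hz.1.2.1 hz.1.2.2
  have hRcard : R.card ≤ T * P.card := by
    have hsub : R ⊆ (P ×ˢ P).filter fun z => κ z.1 = κ z.2 := by
      intro z hz
      simp only [hR, Finset.mem_filter, Finset.mem_offDiag, Finset.mem_product] at hz ⊢
      tauto
    refine (Finset.card_le_card hsub).trans ?_
    have hprod : ((P ×ˢ P).filter fun z => κ z.1 = κ z.2).card =
        ∑ p ∈ P, (P.filter fun p' => κ p = κ p').card := by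
      simp only [Finset.card_filter]
      rw [Finset.sum_product]
    rw [hprod, mul_comm]
    exact Finset.sum_le_card_nsmul _ _ _ hT
  calc ((P ×ˢ L).filter fun z => I z.1 z.2).card
      = ∑ l ∈ L, (P.filter (I · l)).card := hcount
    _ ≤ ∑ l ∈ L, (D + (R.filter fun z => I z.1 l ∧ I z.2 l).card) := Finset.sum_le_sum hcurve
    _ = D * L.card + ∑ l ∈ L, (R.filter fun z => I z.1 l ∧ I z.2 l).card := by
      rw [Finset.sum_add_distrib, Finset.sum_const, smul_eq_mul, mul_comm]
    _ ≤ D * L.card + k * (T * P.card) := by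
      gcongr
      exact hpairs.trans (Nat.mul_le_mul_left k hRcard)

/-- A finite set of `n` reals can be cut into consecutive blocks of size at most `s`, numbered
from `0` to at most `n / s`. -/
lemma exists_monotone_blocks (A : Finset ℝ) {s : ℕ} (hs : 0 < s) :
    ∃ σ : ℝ → ℕ, Monotone σ ∧ (∀ a, σ a ≤ A.card / s) ∧
      ∀ i, (A.filter fun a => i = σ a).card ≤ s := by
  have hmono : Monotone fun a : ℝ => (A.filter (· < a)).card := fun a b hab =>
    Finset.card_le_card (Finset.monotone_filter_right A fun x _ (hx : x < a) => hx.trans_le hab)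
  refine ⟨fun a => (A.filter (· < a)).card / s, fun a b hab => Nat.div_le_div_right (hmono hab),
    fun a => Nat.div_le_div_right (Finset.card_filter_le _ _), fun i => ?_⟩
  have hinj : Set.InjOn (fun a : ℝ => (A.filter (· < a)).card) (A : Set ℝ) := by
    have hlt : ∀ a ∈ A, ∀ b, a < b → (A.filter (· < a)).card < (A.filter (· < b)).card := by
      intro a ha b hab
      refine Finset.card_lt_card (Finset.ssubset_iff_of_subset ?_ |>.2 ⟨a, ?_, ?_⟩)
      · exact Finset.monotone_filter_right A fun x _ (hx : x < a) => hx.trans hab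
      · simp [ha, hab]
      · simp
    intro a ha b hb hab
    rcases lt_trichotomy a b with h | h | h
    · exact absurd hab (hlt a ha b h).ne
    · exact h
    · exact absurd hab (hlt b hb a h).ne'
  calc (A.filter fun a => i = (A.filter (· < a)).card / s).card
      ≤ (Finset.Ico (i * s) (i * s + s)).card := by
        refine Finset.card_le_card_of_injOn (fun a : ℝ => (A.filter (· < a)).card) ?_
          (hinj.mono fun a ha => (Finset.mem_filter.1 ha).1)
        intro a ha
        have h := (Finset.mem_filter.1 ha).2
        have h1 := Nat.div_mul_le_self (A.filter (· < a)).card s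
        have h2 := Nat.lt_div_mul_add (a := (A.filter (· < a)).card) hs
        rw [← h] at h1 h2
        exact Finset.mem_coe.2 (Finset.mem_Ico.2 ⟨h1, h2⟩)
    _ = s := by simp

/-- A weakly increasing planar set meets few cells of a grid. -/
lemma card_cells_le_of_increasing {S : Finset (ℝ × ℝ)} {σ : ℝ → ℕ} (hσ : Monotone σ) {N : ℕ}
    (hN : ∀ a, σ a ≤ N) (hS : ∀ p ∈ S, ∀ q ∈ S, p.1 ≤ q.1 → p.2 ≤ q.2) :
    (S.image fun p => (σ p.1, σ p.2)).card ≤ 2 * N + 1 := by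
  calc (S.image fun p => (σ p.1, σ p.2)).card
      ≤ (Finset.range (2 * N + 1)).card := by
        refine Finset.card_le_card_of_injOn (fun z => z.1 + z.2) ?_ ?_
        · intro z hz
          obtain ⟨p, -, rfl⟩ := Finset.mem_image.1 hz
          have h1 := hN p.1
          have h2 := hN p.2
          simp only [Finset.coe_range, Set.mem_Iio]
          omega
        · intro z hz w hw hzw
          obtain ⟨p, hp, rfl⟩ := Finset.mem_image.1 hz
          obtain ⟨q, hq, rfl⟩ := Finset.mem_image.1 hw
          simp only [Prod.mk.injEq] at hzw ⊢
          rcases le_total p.1 q.1 with h | h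
          · have h1 := hσ h
            have h2 := hσ (hS p hp q hq h)
            omega
          · have h1 := hσ h
            have h2 := hσ (hS q hq p hp h)
            omega
    _ = 2 * N + 1 := Finset.card_range _

/-- A weakly decreasing planar set meets few cells of a grid. -/
lemma card_cells_le_of_decreasing {S : Finset (ℝ × ℝ)} {σ : ℝ → ℕ} (hσ : Monotone σ) {N : ℕ}
    (hN : ∀ a, σ a ≤ N) (hS : ∀ p ∈ S, ∀ q ∈ S, p.1 ≤ q.1 → q.2 ≤ p.2) :
    (S.image fun p => (σ p.1, σ p.2)).card ≤ 2 * N + 1 := by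
  calc (S.image fun p => (σ p.1, σ p.2)).card
      ≤ (Finset.range (2 * N + 1)).card := by
        refine Finset.card_le_card_of_injOn (fun z => z.1 + (N - z.2)) ?_ ?_
        · intro z hz
          obtain ⟨p, -, rfl⟩ := Finset.mem_image.1 hz
          have h1 := hN p.1
          simp only [Finset.coe_range, Set.mem_Iio]
          omega
        · intro z hz w hw hzw
          obtain ⟨p, hp, rfl⟩ := Finset.mem_image.1 hz
          obtain ⟨q, hq, rfl⟩ := Finset.mem_image.1 hw
          have hp2 := hN p.2
          have hq2 := hN q.2
          simp only [Prod.mk.injEq] at hzw ⊢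
          rcases le_total p.1 q.1 with h | h
          · have h1 := hσ h
            have h2 := hσ (hS p hp q hq h)
            omega
          · have h1 := hσ h
            have h2 := hσ (hS q hq p hp h)
            omega
    _ = 2 * N + 1 := Finset.card_range _

/-- A hyperbola with axes parallel to the coordinate axes meets few cells of a grid. -/
lemma card_cells_le_of_hyperbola {S : Finset (ℝ × ℝ)} {σ : ℝ → ℕ} (hσ : Monotone σ) {N : ℕ}
    (hN : ∀ a, σ a ≤ N) (u v k : ℝ) (hS : ∀ p ∈ S, (p.1 - u) ^ 2 - (p.2 - v) ^ 2 = k) :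
    (S.image fun p => (σ p.1, σ p.2)).card ≤ 4 * (2 * N + 1) := by
  have hcover : S = (S.filter fun p => u ≤ p.1 ∧ v ≤ p.2) ∪ (S.filter fun p => u ≤ p.1 ∧ p.2 ≤ v) ∪
      ((S.filter fun p => p.1 ≤ u ∧ v ≤ p.2) ∪ (S.filter fun p => p.1 ≤ u ∧ p.2 ≤ v)) := by
    ext p
    simp only [Finset.mem_union, Finset.mem_filter]
    have h1 := le_total u p.1
    have h2 := le_total v p.2
    tauto
  have h1 : ((S.filter fun p => u ≤ p.1 ∧ v ≤ p.2).image fun p => (σ p.1, σ p.2)).card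
      ≤ 2 * N + 1 := by
    refine card_cells_le_of_increasing hσ hN fun p hp q hq hpq => ?_
    simp only [Finset.mem_filter] at hp hq
    have := hS p hp.1
    have := hS q hq.1
    by_contra! hlt
    nlinarith
  have h2 : ((S.filter fun p => u ≤ p.1 ∧ p.2 ≤ v).image fun p => (σ p.1, σ p.2)).card
      ≤ 2 * N + 1 := by
    refine card_cells_le_of_decreasing hσ hN fun p hp q hq hpq => ?_
    simp only [Finset.mem_filter] at hp hq
    have := hS p hp.1
    have := hS q hq.1
    by_contra! hlt
    nlinarith
  have h3 : ((S.filter fun p => p.1 ≤ u ∧ v ≤ p.2).image fun p => (σ p.1, σ p.2)).card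
      ≤ 2 * N + 1 := by
    refine card_cells_le_of_decreasing hσ hN fun p hp q hq hpq => ?_
    simp only [Finset.mem_filter] at hp hq
    have := hS p hp.1
    have := hS q hq.1
    by_contra! hlt
    nlinarith
  have h4 : ((S.filter fun p => p.1 ≤ u ∧ p.2 ≤ v).image fun p => (σ p.1, σ p.2)).card
      ≤ 2 * N + 1 := by
    refine card_cells_le_of_increasing hσ hN fun p hp q hq hpq => ?_
    simp only [Finset.mem_filter] at hp hq
    have := hS p hp.1
    have := hS q hq.1
    by_contra! hlt
    nlinarith
  rw [hcover]
  simp only [Finset.image_union]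
  refine (Finset.card_union_le _ _).trans ?_
  have h5 := Finset.card_union_le
    ((S.filter fun p => u ≤ p.1 ∧ v ≤ p.2).image fun p => (σ p.1, σ p.2))
    ((S.filter fun p => u ≤ p.1 ∧ p.2 ≤ v).image fun p => (σ p.1, σ p.2))
  have h6 := Finset.card_union_le
    ((S.filter fun p => p.1 ≤ u ∧ v ≤ p.2).image fun p => (σ p.1, σ p.2))
    ((S.filter fun p => p.1 ≤ u ∧ p.2 ≤ v).image fun p => (σ p.1, σ p.2))
  omega

lemma card_le_two_of_quadratic {S : Finset ℝ} {a b d : ℝ} (h : a ≠ 0 ∨ d ≠ 0)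
    (hS : ∀ x ∈ S, a * x ^ 2 + b * x + d = 0) : S.card ≤ 2 := by
  set f : Polynomial ℝ := .C a * .X ^ 2 + .C b * .X + .C d with hf
  have hf0 : f ≠ 0 := by
    intro h0
    rcases h with h | h
    · exact h (by simpa [hf] using congrArg (·.coeff 2) h0)
    · exact h (by simpa [hf] using congrArg (·.coeff 0) h0)
  have hsub : S.val ⊆ f.roots := by
    intro x hx
    rw [Polynomial.mem_roots hf0, Polynomial.IsRoot.def]
    simpa [hf] using hS x hx
  exact (Polynomial.card_le_degree_of_subset_roots hsub).trans Polynomial.natDegree_quadratic_le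

/-- The pairs of points with coordinates `(p.1, q.1)` and `(p.2, q.2)`, taken along two lines
meeting at the origin at an angle of cosine `c`, have equal distances. -/
def EqualDist (c : ℝ) (p q : ℝ × ℝ) : Prop :=
  p.1 ^ 2 + q.1 ^ 2 - 2 * c * p.1 * q.1 = p.2 ^ 2 + q.2 ^ 2 - 2 * c * p.2 * q.2

lemma card_common_equalDist_le_two {c : ℝ} (hc : c ≠ 0) (hc1 : c ^ 2 ≠ 1) {p p' : ℝ × ℝ}
    (hp : p.1 ^ 2 ≠ p.2 ^ 2) (hpp' : p ≠ p') (L : Finset (ℝ × ℝ)) :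
    (L.filter fun q => EqualDist c p q ∧ EqualDist c p' q).card ≤ 2 := by
  obtain ⟨x, x'⟩ := p
  obtain ⟨z, z'⟩ := p'
  simp only at hp
  have hk : (1 - c ^ 2) * (x' ^ 2 - x ^ 2) ≠ 0 :=
    mul_ne_zero (sub_ne_zero.2 hc1.symm) (sub_ne_zero.2 hp.symm)
  have hinj : Set.InjOn (fun q : ℝ × ℝ => (q.1 - c * x) - (q.2 - c * x'))
      ((L.filter fun q => EqualDist c (x, x') q ∧ EqualDist c (z, z') q : Finset (ℝ × ℝ)) :
        Set (ℝ × ℝ)) := by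
    rintro ⟨y, y'⟩ hy ⟨w, w'⟩ hw hyw
    rw [Finset.mem_coe, Finset.mem_filter] at hy hw
    simp only [EqualDist] at hy hw hyw
    have h1 : ((y - c * x) - (y' - c * x')) * ((y - c * x) + (y' - c * x')) =
        (1 - c ^ 2) * (x' ^ 2 - x ^ 2) := by linear_combination hy.2.1
    have h2 : ((w - c * x) - (w' - c * x')) * ((w - c * x) + (w' - c * x')) =
        (1 - c ^ 2) * (x' ^ 2 - x ^ 2) := by linear_combination hw.2.1
    rw [← hyw, ← h1] at h2
    have h0 : (y - c * x) - (y' - c * x') ≠ 0 := fun h0 => hk (by rw [← h1, h0, zero_mul])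
    have h3 := mul_left_cancel₀ h0 h2
    simp only [Prod.mk.injEq]
    constructor <;> linarith
  rw [← Finset.card_image_of_injOn hinj]
  refine card_le_two_of_quadratic (a := c * ((x - z) + (x' - z')))
    (b := -((z' ^ 2 - z ^ 2) - (x' ^ 2 - x ^ 2)
      - 2 * c ^ 2 * ((x - z) * x - (x' - z') * x')))
    (d := c * ((x - z) - (x' - z')) * ((1 - c ^ 2) * (x' ^ 2 - x ^ 2))) ?_ ?_
  · by_contra! h
    obtain ⟨ha, hd⟩ := h
    have h1 := (mul_eq_zero.1 ha).resolve_left hc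
    have h2 := (mul_eq_zero.1 ((mul_eq_zero.1 hd).resolve_right hk)).resolve_left hc
    refine hpp' (Prod.ext ?_ ?_) <;> simp only <;> linarith
  · intro U hU
    obtain ⟨⟨y, y'⟩, hy, rfl⟩ := Finset.mem_image.1 hU
    obtain ⟨-, h1, h2⟩ := Finset.mem_filter.1 hy
    simp only [EqualDist] at h1 h2 ⊢
    linear_combination ((y - c * x) - (y' - c * x')) * (h2 - h1) -
      c * ((x - z) - (x' - z')) * h1

lemma card_equalDist_degenerate_le (c : ℝ) (A B : Finset ℝ) :
    ((((A ×ˢ A).filter fun p => p.1 ^ 2 = p.2 ^ 2) ×ˢ (B ×ˢ B)).filter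
      fun z => EqualDist c z.1 z.2).card ≤ 4 * A.card * B.card := by
  set P := (A ×ˢ A).filter fun p : ℝ × ℝ => p.1 ^ 2 = p.2 ^ 2 with hP
  have hPcard : P.card ≤ A.card * 2 := by
    have hcount : P.card = ∑ x ∈ A, (A.filter fun x' => x ^ 2 = x' ^ 2).card := by
      simp only [hP, Finset.card_filter]
      rw [Finset.sum_product]
    rw [hcount]
    refine Finset.sum_le_card_nsmul _ _ _ fun x _ => ?_
    refine card_le_two_of_quadratic (a := 1) (b := 0) (d := -x ^ 2) (Or.inl one_ne_zero) ?_
    intro x' hx'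
    linear_combination -(Finset.mem_filter.1 hx').2
  have hfib : ∀ p ∈ P, ((B ×ˢ B).filter fun q => EqualDist c p q).card ≤ B.card * 2 := by
    intro p _
    have hcount : ((B ×ˢ B).filter fun q => EqualDist c p q).card =
        ∑ y ∈ B, (B.filter fun y' => EqualDist c p (y, y')).card := by
      simp only [Finset.card_filter]
      rw [Finset.sum_product]
    rw [hcount]
    refine Finset.sum_le_card_nsmul _ _ _ fun y _ => ?_
    refine card_le_two_of_quadratic (a := 1) (b := -2 * c * p.2)
      (d := p.2 ^ 2 - (p.1 ^ 2 + y ^ 2 - 2 * c * p.1 * y)) (Or.inl one_ne_zero) ?_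
    intro y' hy'
    have := (Finset.mem_filter.1 hy').2
    simp only [EqualDist] at this
    linear_combination -this
  have hcount : ((P ×ˢ (B ×ˢ B)).filter fun z => EqualDist c z.1 z.2).card =
      ∑ p ∈ P, ((B ×ˢ B).filter fun q => EqualDist c p q).card := by
    simp only [Finset.card_filter]
    rw [Finset.sum_product]
  rw [hcount]
  calc ∑ p ∈ P, ((B ×ˢ B).filter fun q => EqualDist c p q).card
      ≤ P.card * (B.card * 2) := Finset.sum_le_card_nsmul _ _ _ hfib
    _ ≤ A.card * 2 * (B.card * 2) := Nat.mul_le_mul_right _ hPcard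
    _ = 4 * A.card * B.card := by ring

lemma card_equalDist_le {c : ℝ} (hc : c ≠ 0) (hc1 : c ^ 2 ≠ 1) (A B : Finset ℝ) {s : ℕ}
    (hs : 0 < s) :
    (((A ×ˢ A) ×ˢ (B ×ˢ B)).filter fun z => EqualDist c z.1 z.2).card ≤
      4 * A.card * B.card + 4 * (2 * (A.card / s) + 1) * B.card ^ 2 + 2 * s ^ 2 * A.card ^ 2 := by
  obtain ⟨σ, hσ, hσle, hσcard⟩ := exists_monotone_blocks A hs
  set P := (A ×ˢ A).filter fun p : ℝ × ℝ => p.1 ^ 2 ≠ p.2 ^ 2 with hP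
  have hmain : ((P ×ˢ (B ×ˢ B)).filter fun z => EqualDist c z.1 z.2).card ≤
      4 * (2 * (A.card / s) + 1) * (B ×ˢ B).card + 2 * (s * s * P.card) := by
    refine card_incidences_le_s11 P (B ×ˢ B) (EqualDist c) (fun p => (σ p.1, σ p.2)) _ _ _ ?_ ?_ ?_
    · intro q _
      refine card_cells_le_of_hyperbola hσ hσle (c * q.1) (c * q.2)
        ((1 - c ^ 2) * (q.2 ^ 2 - q.1 ^ 2)) fun p hp => ?_
      have := (Finset.mem_filter.1 hp).2
      simp only [EqualDist] at this
      linear_combination this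
    · intro p hp p' _ hpp'
      exact card_common_equalDist_le_two hc hc1 (Finset.mem_filter.1 hp).2 hpp' _
    · intro p _
      calc (P.filter fun p' => (σ p.1, σ p.2) = (σ p'.1, σ p'.2)).card
          ≤ ((A.filter fun a => σ p.1 = σ a) ×ˢ (A.filter fun a => σ p.2 = σ a)).card := by
            refine Finset.card_le_card fun q hq => ?_
            simp only [hP, Finset.mem_filter, Finset.mem_product, Prod.mk.injEq] at hq ⊢
            tauto
        _ ≤ s * s := by
            rw [Finset.card_product]
            exact Nat.mul_le_mul (hσcard _) (hσcard _)
  have hPcard : P.card ≤ A.card ^ 2 := by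
    refine (Finset.card_filter_le _ _).trans ?_
    rw [Finset.card_product, sq]
  have hsub : ((A ×ˢ A) ×ˢ (B ×ˢ B)).filter (fun z => EqualDist c z.1 z.2) ⊆
      ((((A ×ˢ A).filter fun p => p.1 ^ 2 = p.2 ^ 2) ×ˢ (B ×ˢ B)).filter
        fun z => EqualDist c z.1 z.2) ∪ ((P ×ˢ (B ×ˢ B)).filter fun z => EqualDist c z.1 z.2) := by
    intro z hz
    simp only [hP, Finset.mem_union, Finset.mem_filter, Finset.mem_product] at hz ⊢
    tauto
  have hunion := (Finset.card_le_card hsub).trans (Finset.card_union_le _ _)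
  have hdeg := card_equalDist_degenerate_le c A B
  rw [Finset.card_product] at hmain
  have : 2 * (s * s * P.card) ≤ 2 * (s * s * A.card ^ 2) := by gcongr
  nlinarith

/-- Optimizing the block size `s` in `card_equalDist_le`. -/
lemma card_equalDist_le_rpow {c : ℝ} (hc : c ≠ 0) (hc1 : c ^ 2 ≠ 1) (A B : Finset ℝ)
    (hAB : B.card ≤ A.card) :
    ((((A ×ˢ A) ×ˢ (B ×ˢ B)).filter fun z => EqualDist c z.1 z.2).card : ℝ) ≤
      16 * ((B.card : ℝ) ^ (4/3 : ℝ) * (A.card : ℝ) ^ (4/3 : ℝ) + (A.card : ℝ) ^ 2) := by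
  rcases B.eq_empty_or_nonempty with rfl | hB
  · simp only [Finset.product_empty, Finset.filter_empty, Finset.card_empty, Nat.cast_zero]
    positivity
  have hm : 0 < B.card := hB.card_pos
  set n := A.card
  set m := B.card
  have hm' : (1 : ℝ) ≤ m := by exact_mod_cast hm
  have hnm : (m : ℝ) ≤ n := by exact_mod_cast hAB
  obtain ⟨a, ha⟩ : ∃ a : ℝ, a = (n : ℝ) ^ (1/3 : ℝ) := ⟨_, rfl⟩
  obtain ⟨b, hb⟩ : ∃ b : ℝ, b = (m : ℝ) ^ (1/3 : ℝ) := ⟨_, rfl⟩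
  have hb1 : 1 ≤ b := hb ▸ Real.one_le_rpow hm' (by norm_num)
  have hba : b ≤ a := by
    rw [ha, hb]
    exact Real.rpow_le_rpow (by linarith) hnm (by norm_num)
  have ha3 : (n : ℝ) = a ^ 3 := by
    rw [ha, ← Real.rpow_natCast, ← Real.rpow_mul (by linarith)]
    norm_num
  have hb3 : (m : ℝ) = b ^ 3 := by
    rw [hb, ← Real.rpow_natCast, ← Real.rpow_mul (by linarith)]
    norm_num
  have ha4 : (n : ℝ) ^ (4/3 : ℝ) = a ^ 4 := by
    rw [ha, ← Real.rpow_natCast, ← Real.rpow_mul (by linarith)]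
    norm_num
  have hb4 : (m : ℝ) ^ (4/3 : ℝ) = b ^ 4 := by
    rw [hb, ← Real.rpow_natCast, ← Real.rpow_mul (by linarith)]
    norm_num
  have ha0 : 0 < a := by linarith
  have hb0 : 0 < b := by linarith
  set s := ⌈b ^ 2 / a⌉₊
  have hs : 0 < s := Nat.ceil_pos.2 (by positivity)
  have hsz : b ^ 2 / a ≤ s := Nat.le_ceil _
  have hsz' : (s : ℝ) ≤ b ^ 2 / a + 1 := (Nat.ceil_lt_add_one (by positivity)).le
  have hsn : s ≤ n := by
    refine Nat.ceil_le.2 ?_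
    rw [ha3, div_le_iff₀ ha0]
    nlinarith [pow_le_pow_left₀ hb0.le hba 2, one_le_pow₀ (n := 2) (hb1.trans hba)]
  have hcount := card_equalDist_le hc hc1 A B hs
  have hcount' : ((((A ×ˢ A) ×ˢ (B ×ˢ B)).filter fun z => EqualDist c z.1 z.2).card : ℝ) ≤
      4 * n * m + 4 * (2 * ((n / s : ℕ) : ℝ) + 1) * m ^ 2 + 2 * s ^ 2 * n ^ 2 := by
    exact_mod_cast hcount
  have hs0 : (0 : ℝ) < s := by exact_mod_cast hs
  have hdiv : ((n / s : ℕ) : ℝ) ≤ n / s := Nat.cast_div_le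
  have hone : (1 : ℝ) ≤ n / s := (one_le_div hs0).2 (by exact_mod_cast hsn)
  have hns : (n : ℝ) / s * m ^ 2 ≤ b ^ 4 * a ^ 4 := by
    rw [div_mul_eq_mul_div, div_le_iff₀ hs0, ha3, hb3]
    calc a ^ 3 * (b ^ 3) ^ 2 = b ^ 4 * a ^ 4 * (b ^ 2 / a) := by field_simp
      _ ≤ b ^ 4 * a ^ 4 * s := by gcongr
  have hsq : (s : ℝ) ^ 2 * n ^ 2 ≤ 2 * (b ^ 4 * a ^ 4) + 2 * n ^ 2 := by
    have h1 : (s : ℝ) ^ 2 ≤ 2 * (b ^ 2 / a) ^ 2 + 2 := by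
      nlinarith [sq_nonneg (b ^ 2 / a - 1), pow_le_pow_left₀ hs0.le hsz' 2]
    calc (s : ℝ) ^ 2 * n ^ 2 ≤ (2 * (b ^ 2 / a) ^ 2 + 2) * n ^ 2 :=
        mul_le_mul_of_nonneg_right h1 (sq_nonneg _)
      _ = 2 * (b ^ 4 * a ^ 4) + 2 * n ^ 2 := by
        rw [ha3]
        field_simp
  have hmid : 4 * (2 * ((n / s : ℕ) : ℝ) + 1) * m ^ 2 ≤ 12 * ((n : ℝ) / s * m ^ 2) := by
    have : 4 * (2 * ((n / s : ℕ) : ℝ) + 1) ≤ 12 * ((n : ℝ) / s) := by linarith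
    nlinarith [sq_nonneg (m : ℝ)]
  have hnm2 : (n : ℝ) * m ≤ n ^ 2 := by nlinarith
  rw [ha4, hb4]
  nlinarith [sq_nonneg (n : ℝ)]

/-- Two non-parallel lines in the plane meet. -/
lemma exists_inter_of_not_parallel {v₁ v₂ : EuclideanSpace ℝ (Fin 2)}
    (hdet : v₁ 0 * v₂ 1 - v₁ 1 * v₂ 0 ≠ 0) (o₁ o₂ : EuclideanSpace ℝ (Fin 2)) :
    ∃ t u : ℝ, o₁ + t • v₁ = o₂ + u • v₂ := by
  obtain ⟨d, hd⟩ : ∃ d, d = v₁ 0 * v₂ 1 - v₁ 1 * v₂ 0 := ⟨_, rfl⟩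
  rw [← hd] at hdet
  refine ⟨((o₂ 0 - o₁ 0) * v₂ 1 - (o₂ 1 - o₁ 1) * v₂ 0) / d,
    ((o₂ 0 - o₁ 0) * v₁ 1 - (o₂ 1 - o₁ 1) * v₁ 0) / d, ?_⟩
  ext i
  fin_cases i
  · simp only [Fin.zero_eta, PiLp.add_apply, PiLp.smul_apply, smul_eq_mul]
    field_simp
    rw [hd]
    ring
  · simp only [Fin.mk_one, PiLp.add_apply, PiLp.smul_apply, smul_eq_mul]
    field_simp
    rw [hd]
    ring

lemma dist_sq_eq_of_unit {E : Type*} [NormedAddCommGroup E] [InnerProductSpace ℝ E] {w₁ w₂ : E}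
    (h₁ : ‖w₁‖ = 1) (h₂ : ‖w₂‖ = 1) (o : E) (x y : ℝ) :
    dist (o + x • w₁) (o + y • w₂) ^ 2 = x ^ 2 + y ^ 2 - 2 * ⟪w₁, w₂⟫ * x * y := by
  rw [dist_add_left, dist_eq_norm, norm_sub_sq_real, norm_smul, norm_smul, h₁, h₂,
    real_inner_smul_left, real_inner_smul_right]
  simp only [Real.norm_eq_abs, mul_one, sq_abs]
  ring

/-- Points on a line through `o + t • v` have a coordinate along the unit direction of `v`. -/
lemma exists_unit_coordinate {E : Type*} [NormedAddCommGroup E] [NormedSpace ℝ E]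
    {P : Finset E} {o v : E} (hv : v ≠ 0) (hP : ∀ p ∈ P, ∃ t : ℝ, p = o + t • v) (t₀ : ℝ) :
    ∃ f : E → ℝ, ∀ p ∈ P, p = (o + t₀ • v) + f p • (‖v‖⁻¹ • v) := by
  have hv' : ‖v‖ ≠ 0 := norm_ne_zero_iff.2 hv
  choose! f hf using hP
  refine ⟨fun p => (f p - t₀) * ‖v‖, fun p hp => ?_⟩
  rw [smul_smul, mul_assoc, mul_inv_cancel₀ hv', mul_one, sub_smul, add_assoc, add_sub_cancel]
  exact hf p hp

/-- The upper bound on the number of quadruples: if `P₁` (of size `n`) and `P₂` (of size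
`m ≤ n`) lie on two lines that are neither parallel nor orthogonal, then the set `Q` of ordered
quadruples `(a,p,b,q)` with `dist(a,p) = dist(b,q) > 0` and `(a,p) ≠ (b,q)` satisfies
`|Q| ≤ C (m^{4/3} n^{4/3} + n²)` for an absolute constant `C`. -/
theorem quadruples_upper_bound :
    ∃ C : ℝ, 0 < C ∧
      ∀ (P₁ P₂ : Finset (EuclideanSpace ℝ (Fin 2)))
        (o₁ v₁ o₂ v₂ : EuclideanSpace ℝ (Fin 2)) (n m : ℕ),
        P₁.card = n → P₂.card = m → m ≤ n →
        v₁ ≠ 0 → v₂ ≠ 0 →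
        (∀ p ∈ P₁, ∃ t : ℝ, p = o₁ + t • v₁) →
        (∀ p ∈ P₂, ∃ t : ℝ, p = o₂ + t • v₂) →
        (¬ ∃ r : ℝ, v₂ = r • v₁) →
        ⟪v₁, v₂⟫ ≠ (0 : ℝ) →
        (((((P₁ ×ˢ P₂) ×ˢ (P₁ ×ˢ P₂)).filter fun z =>
            dist z.1.1 z.1.2 = dist z.2.1 z.2.2 ∧ 0 < dist z.1.1 z.1.2 ∧ z.1 ≠ z.2).card : ℝ)
          ≤ C * ((m : ℝ) ^ (4/3 : ℝ) * (n : ℝ) ^ (4/3 : ℝ) + (n : ℝ) ^ 2)) := by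
  refine ⟨16, by norm_num, ?_⟩
  rintro P₁ P₂ o₁ v₁ o₂ v₂ n m rfl rfl hmn hv₁ hv₂ hP₁ hP₂ hpar horth
  have hdet : v₁ 0 * v₂ 1 - v₁ 1 * v₂ 0 ≠ 0 := by
    intro hdet
    have hcoord : v₁ 0 ≠ 0 ∨ v₁ 1 ≠ 0 := by
      by_contra! h
      exact hv₁ (by ext i; fin_cases i <;> simp [h])
    refine hpar ?_
    rcases hcoord with h | h
    · refine ⟨v₂ 0 / v₁ 0, ?_⟩
      ext i
      fin_cases i
      · simp [h]
      · simp only [Fin.mk_one, PiLp.smul_apply, smul_eq_mul]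
        field_simp
        linarith
    · refine ⟨v₂ 1 / v₁ 1, ?_⟩
      ext i
      fin_cases i
      · simp only [Fin.zero_eta, PiLp.smul_apply, smul_eq_mul]
        field_simp
        linarith
      · simp [h]
  obtain ⟨t, u, htu⟩ := exists_inter_of_not_parallel hdet o₁ o₂
  obtain ⟨f, hf⟩ := exists_unit_coordinate hv₁ hP₁ t
  obtain ⟨g, hg⟩ := exists_unit_coordinate hv₂ hP₂ u
  rw [← htu] at hg
  set o := o₁ + t • v₁
  set w₁ := ‖v₁‖⁻¹ • v₁ with hw₁
  set w₂ := ‖v₂‖⁻¹ • v₂ with hw₂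
  have hn₁ : ‖v₁‖ ≠ 0 := norm_ne_zero_iff.2 hv₁
  have hn₂ : ‖v₂‖ ≠ 0 := norm_ne_zero_iff.2 hv₂
  have hu₁ : ‖w₁‖ = 1 := by rw [hw₁, norm_smul, norm_inv, norm_norm, inv_mul_cancel₀ hn₁]
  have hu₂ : ‖w₂‖ = 1 := by rw [hw₂, norm_smul, norm_inv, norm_norm, inv_mul_cancel₀ hn₂]
  have hcv : ⟪w₁, w₂⟫ = ‖v₁‖⁻¹ * (‖v₂‖⁻¹ * ⟪v₁, v₂⟫) := by
    rw [hw₁, hw₂, real_inner_smul_left, real_inner_smul_right]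
  have hc : ⟪w₁, w₂⟫ ≠ 0 := by
    rw [hcv]
    exact mul_ne_zero (inv_ne_zero hn₁) (mul_ne_zero (inv_ne_zero hn₂) horth)
  have hc1 : ⟪w₁, w₂⟫ ^ 2 ≠ 1 := by
    intro h
    have hlag : (v₁ 0 * v₂ 1 - v₁ 1 * v₂ 0) ^ 2 = ‖v₁‖ ^ 2 * ‖v₂‖ ^ 2 - ⟪v₁, v₂⟫ ^ 2 := by
      rw [EuclideanSpace.real_norm_sq_eq, EuclideanSpace.real_norm_sq_eq, PiLp.inner_apply]
      simp only [Fin.sum_univ_two, RCLike.inner_apply, conj_trivial]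
      ring
    have hsq : ⟪v₁, v₂⟫ ^ 2 = ‖v₁‖ ^ 2 * ‖v₂‖ ^ 2 := by
      rw [hcv] at h
      field_simp at h
      linarith
    exact hdet (pow_eq_zero_iff two_ne_zero |>.1 (by rw [hlag, hsq, sub_self]))
  have hfinj : Set.InjOn f (P₁ : Set (EuclideanSpace ℝ (Fin 2))) := fun p hp q hq h => by
    rw [hf p hp, hf q hq, h]
  have hginj : Set.InjOn g (P₂ : Set (EuclideanSpace ℝ (Fin 2))) := fun p hp q hq h => by
    rw [hg p hp, hg q hq, h]
  have hcardA : (P₁.image f).card = P₁.card := Finset.card_image_of_injOn hfinj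
  have hcardB : (P₂.image g).card = P₂.card := Finset.card_image_of_injOn hginj
  have hbound := card_equalDist_le_rpow hc hc1 (P₁.image f) (P₂.image g) (by
    rw [hcardA, hcardB]
    exact hmn)
  rw [hcardA, hcardB] at hbound
  refine le_trans ?_ hbound
  refine Nat.cast_le.2 (Finset.card_le_card_of_injOn
    (fun z => ((f z.1.1, f z.2.1), (g z.1.2, g z.2.2))) ?_ ?_)
  · rintro ⟨⟨a, p⟩, ⟨b, q⟩⟩ hz
    simp only [Finset.coe_filter, Finset.mem_product, Set.mem_ofPred_eq, Finset.mem_image] at hz ⊢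
    obtain ⟨⟨⟨ha, hp⟩, hb, hq⟩, hd, -⟩ := hz
    refine ⟨⟨⟨⟨a, ha, rfl⟩, b, hb, rfl⟩, ⟨p, hp, rfl⟩, q, hq, rfl⟩, ?_⟩
    have h : dist a p ^ 2 = dist b q ^ 2 := by rw [hd]
    rw [hf a ha, hf b hb, hg p hp, hg q hq, dist_sq_eq_of_unit hu₁ hu₂,
      dist_sq_eq_of_unit hu₁ hu₂] at h
    exact h
  · rintro ⟨⟨a, p⟩, ⟨b, q⟩⟩ hz ⟨⟨a', p'⟩, ⟨b', q'⟩⟩ hz' h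
    simp only [Finset.coe_filter, Finset.mem_product, Set.mem_ofPred_eq] at hz hz'
    simp only [Prod.mk.injEq] at h ⊢
    exact ⟨⟨hfinj hz.1.1.1 hz'.1.1.1 h.1.1, hginj hz.1.1.2 hz'.1.1.2 h.2.1⟩,
      hfinj hz.1.2.1 hz'.1.2.1 h.1.2, hginj hz.1.2.2 hz'.1.2.2 h.2.2⟩
end
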